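/- Let T = {T_1, ..., T_m} be a set of m rooted phylogenetic trees on a finite taxa set X and let C = Cl(T). Let p be the MST lower bound for C. Then r(C) ≤ (m−1)·p. -/

import Mathlib

open scoped Classical

namespace Phylo

variable {α : Type} [DecidableEq α]

/-- A finite directed graph whose vertices carry labels from `α`; used to model
rooted phylogenetic networks and trees. -/
structure Net (α : Type) where
  n : ℕ
  E : Finset (Fin n × Fin n)
  label : Fin n → α

namespace Net

def indeg (N : Net α) (v : Fin N.n) : ℕ := (N.E.filter fun e => e.2 = v).card

def outdeg (N : Net α) (v : Fin N.n) : ℕ := (N.E.filter fun e => e.1 = v).card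

def Adj (N : Net α) (u v : Fin N.n) : Prop := (u, v) ∈ N.E

def Reaches (N : Net α) : Fin N.n → Fin N.n → Prop := Relation.ReflTransGen N.Adj

def IsLeaf (N : Net α) (v : Fin N.n) : Prop := N.outdeg v = 0

/-- The set of labels of leaves reachable from `v` by directed paths. -/
noncomputable def clusterBelow (N : Net α) (v : Fin N.n) : Finset α :=
  (Finset.univ.filter fun w => N.Reaches v w ∧ N.IsLeaf w).image N.label

/-- The reticulation number `r(N) = Σ_{v : indeg(v) > 0} (indeg(v) - 1)`. -/
def reticNum (N : Net α) : ℕ := ∑ v, (N.indeg v - 1)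

end Net

/-- `N` is a rooted phylogenetic network on the taxa set `X`: an acyclic digraph with a
unique root (indegree-0 node), no node with indegree 1 and outdegree 1, every
reticulation (indegree ≥ 2) having outdegree ≥ 1, and leaves bijectively labeled by `X`. -/
def IsPhyloNet (X : Finset α) (N : Net α) : Prop :=
  (∀ v : Fin N.n, ¬ Relation.TransGen N.Adj v v) ∧
  (∃! ρ : Fin N.n, N.indeg ρ = 0) ∧
  (∀ v : Fin N.n, ¬ (N.indeg v = 1 ∧ N.outdeg v = 1)) ∧
  (∀ v : Fin N.n, 2 ≤ N.indeg v → 1 ≤ N.outdeg v) ∧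
  Set.BijOn N.label {v | N.IsLeaf v} (X : Set α)

/-- A rooted phylogenetic tree on `X` is a network on `X` with reticulation number 0. -/
def IsPhyloTree (X : Finset α) (N : Net α) : Prop := IsPhyloNet X N ∧ N.reticNum = 0

/-- A network is binary if every reticulation has indegree 2 and outdegree 1 and every
non-leaf tree node has outdegree 2. -/
def IsBinary (N : Net α) : Prop :=
  ∀ v : Fin N.n, (N.indeg v ≤ 1 → N.outdeg v = 0 ∨ N.outdeg v = 2) ∧
    (2 ≤ N.indeg v → N.indeg v = 2 ∧ N.outdeg v = 1)

/-- The internal vertices of a path given as a list of vertices. -/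
def internals {β : Type*} (p : List β) : List β := p.tail.dropLast

def IsDirPath (N : Net α) (u v : Fin N.n) (p : List (Fin N.n)) : Prop :=
  p.head? = some u ∧ p.getLast? = some v ∧ p.Chain' N.Adj ∧ 2 ≤ p.length

/-- `N` displays `T`: `T` can be obtained from `N` by deleting nodes and edges and
suppressing indegree-1 outdegree-1 nodes, formalized as a topological embedding:
each edge of `T` maps to a directed path of `N`, paths being internally disjoint
from each other and from the images of the nodes of `T`, and leaves of `T` map to
leaves of `N` with the same label. -/
def Displays (N T : Net α) : Prop :=
  ∃ φ : Fin T.n → Fin N.n, Function.Injective φ ∧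
    (∀ v, T.IsLeaf v → N.IsLeaf (φ v) ∧ N.label (φ v) = T.label v) ∧
    ∃ P : Fin T.n × Fin T.n → List (Fin N.n),
      (∀ e ∈ T.E, IsDirPath N (φ e.1) (φ e.2) (P e)) ∧
      (∀ e ∈ T.E, ∀ w ∈ internals (P e), w ∉ Set.range φ) ∧
      (∀ e ∈ T.E, ∀ f ∈ T.E, e ≠ f → ∀ w ∈ internals (P e), w ∉ internals (P f))

/-- `N` represents the cluster `C` in the softwired sense: some tree on `X` displayed by
`N` has an edge whose set of leaf descendants is exactly `C`. -/
def RepresentsCluster (X : Finset α) (N : Net α) (C : Finset α) : Prop :=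
  ∃ T : Net α, IsPhyloTree X T ∧ Displays N T ∧ ∃ e ∈ T.E, T.clusterBelow e.2 = C

def RepresentsSet (X : Finset α) (N : Net α) (𝒞 : Set (Finset α)) : Prop :=
  ∀ C ∈ 𝒞, RepresentsCluster X N C

/-- `Cl(T)`: the set of clusters represented by edges of the tree `T`. -/
def clSet (T : Net α) : Set (Finset α) := {C | ∃ e ∈ T.E, T.clusterBelow e.2 = C}

/-- `r(𝒞)`: the minimum reticulation number of a network on `X` representing `𝒞`. -/
noncomputable def rNum (X : Finset α) (𝒞 : Set (Finset α)) : ℕ :=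
  sInf {k | ∃ N : Net α, IsPhyloNet X N ∧ RepresentsSet X N 𝒞 ∧ N.reticNum = k}

/-- A cluster on `X` is a nonempty proper subset of `X`. -/
def IsCluster (X C : Finset α) : Prop := C ⊆ X ∧ C.Nonempty ∧ C ≠ X

def IsClusterSet (X : Finset α) (𝒞 : Set (Finset α)) : Prop := ∀ C ∈ 𝒞, IsCluster X C

def Compatible (A B : Finset α) : Prop := A ∩ B = ∅ ∨ A ⊆ B ∨ B ⊆ A

/-- `𝒞 \ S`: remove the elements of `S` from each cluster, discarding emptied clusters. -/
def removeTaxa (𝒞 : Set (Finset α)) (S : Finset α) : Set (Finset α) :=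
  {D | D.Nonempty ∧ ∃ C ∈ 𝒞, D = C \ S}

/-- `𝒞 | S`: the restriction of `𝒞` to `S`. -/
def restrictTo (𝒞 : Set (Finset α)) (S : Finset α) : Set (Finset α) :=
  {D | D.Nonempty ∧ ∃ C ∈ 𝒞, D = C ∩ S}

/-- `S` is unseparated by `𝒞`: no cluster of `𝒞` is incompatible with `S`. -/
def Unseparated (𝒞 : Set (Finset α)) (S : Finset α) : Prop := ∀ C ∈ 𝒞, Compatible C S

/-- `𝒞` separates every proper subset of `X` with at least two elements. -/
def Separating (X : Finset α) (𝒞 : Set (Finset α)) : Prop :=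
  ∀ X' : Finset α, X' ⊂ X → 2 ≤ X'.card → ∃ C ∈ 𝒞, ¬ Compatible C X'

def PairwiseCompatible (𝒞 : Set (Finset α)) : Prop := ∀ A ∈ 𝒞, ∀ B ∈ 𝒞, Compatible A B

/-- `S` is an ST-set with respect to `𝒞`. -/
def IsSTSet (X : Finset α) (𝒞 : Set (Finset α)) (S : Finset α) : Prop :=
  S ⊆ X ∧ Unseparated 𝒞 S ∧ PairwiseCompatible (restrictTo 𝒞 S)

/-- `S` is a maximal ST-set: no ST-set properly contains it. -/
def IsMaxSTSet (X : Finset α) (𝒞 : Set (Finset α)) (S : Finset α) : Prop :=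
  IsSTSet X 𝒞 S ∧ ∀ S', IsSTSet X 𝒞 S' → ¬ S ⊂ S'

/-- `(S₁, …, S_p)` is a maximal ST-set sequence of `𝒞`. -/
def IsMaxSTSeq : Finset α → Set (Finset α) → List (Finset α) → Prop
  | _, _, [] => True
  | X, 𝒞, S :: L => IsMaxSTSet X 𝒞 S ∧ IsMaxSTSeq (X \ S) (removeTaxa 𝒞 S) L

/-- `(S₁, …, S_p)` is an ST-set sequence of `𝒞` (empty ST-sets allowed). -/
def IsSTSeq : Finset α → Set (Finset α) → List (Finset α) → Prop
  | _, _, [] => True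
  | X, 𝒞, S :: L => IsSTSet X 𝒞 S ∧ IsSTSeq (X \ S) (removeTaxa 𝒞 S) L

def removeAll (𝒞 : Set (Finset α)) (L : List (Finset α)) : Set (Finset α) :=
  L.foldl removeTaxa 𝒞

/-- A maximal ST-set *tree* sequence: additionally the remaining clusters are pairwise
compatible. -/
def IsMaxSTTreeSeq (X : Finset α) (𝒞 : Set (Finset α)) (L : List (Finset α)) : Prop :=
  IsMaxSTSeq X 𝒞 L ∧ PairwiseCompatible (removeAll 𝒞 L)

def IsSTTreeSeq (X : Finset α) (𝒞 : Set (Finset α)) (L : List (Finset α)) : Prop :=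
  IsSTSeq X 𝒞 L ∧ PairwiseCompatible (removeAll 𝒞 L)

/-- The MST lower bound: minimum length of a maximal ST-set tree sequence of `𝒞`. -/
noncomputable def mstLB (X : Finset α) (𝒞 : Set (Finset α)) : ℕ :=
  sInf {p | ∃ L, IsMaxSTTreeSeq X 𝒞 L ∧ L.length = p}

/- Underlying undirected notions, biconnected components and the level of a network. -/

def uadj (N : Net α) (F : Finset (Fin N.n × Fin N.n)) (u v : Fin N.n) : Prop :=
  (u, v) ∈ F ∨ (v, u) ∈ F

def verts (N : Net α) (F : Finset (Fin N.n × Fin N.n)) : Finset (Fin N.n) :=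
  F.image Prod.fst ∪ F.image Prod.snd

def ConnOn (N : Net α) (F : Finset (Fin N.n × Fin N.n)) : Prop :=
  ∀ u ∈ verts N F, ∀ v ∈ verts N F, Relation.ReflTransGen (uadj N F) u v

def delVert (N : Net α) (F : Finset (Fin N.n × Fin N.n)) (v : Fin N.n) :
    Finset (Fin N.n × Fin N.n) :=
  F.filter fun e => e.1 ≠ v ∧ e.2 ≠ v

def HasCutNodeOn (N : Net α) (F : Finset (Fin N.n × Fin N.n)) : Prop :=
  ∃ v ∈ verts N F, ∃ a ∈ verts N F, ∃ b ∈ verts N F, a ≠ v ∧ b ≠ v ∧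
    ¬ Relation.ReflTransGen (uadj N (delVert N F v)) a b

/-- The (edge set of a) subgraph is biconnected: connected and without cut-nodes. -/
def Biconn (N : Net α) (F : Finset (Fin N.n × Fin N.n)) : Prop :=
  F.Nonempty ∧ ConnOn N F ∧ ¬ HasCutNodeOn N F

/-- `F` is a biconnected component of `N`: a maximal biconnected subgraph. -/
def IsBCC (N : Net α) (F : Finset (Fin N.n × Fin N.n)) : Prop :=
  F ⊆ N.E ∧ Biconn N F ∧ ∀ F', F' ⊆ N.E → Biconn N F' → F ⊆ F' → F' = F

/-- Reticulation number of a biconnected component, indegrees computed within it. -/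
def compRetic (N : Net α) (F : Finset (Fin N.n × Fin N.n)) : ℕ :=
  ∑ v ∈ verts N F, ((F.filter fun e => e.2 = v).card - 1)

/-- The level of `N`: the maximum reticulation number of a biconnected component. -/
noncomputable def level (N : Net α) : ℕ :=
  sSup {k | ∃ F, IsBCC N F ∧ compRetic N F = k}

def IsCutEdge (N : Net α) (e : Fin N.n × Fin N.n) : Prop :=
  e ∈ N.E ∧ ∃ a b : Fin N.n, ¬ Relation.ReflTransGen (uadj N (N.E.erase e)) a b

def IsCutNode (N : Net α) (v : Fin N.n) : Prop :=
  ∃ a b : Fin N.n, a ≠ v ∧ b ≠ v ∧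
    ¬ Relation.ReflTransGen (uadj N (delVert N N.E v)) a b

/-- `N` is simple: removal of any cut-node or cut-edge leaves at most one non-trivial
connected component (all remaining edges lie in a single component). -/
def IsSimpleNet (N : Net α) : Prop :=
  (∀ v : Fin N.n, IsCutNode N v → ∀ f ∈ delVert N N.E v, ∀ g ∈ delVert N N.E v,
      Relation.ReflTransGen (uadj N (delVert N N.E v)) f.1 g.1) ∧
  (∀ e : Fin N.n × Fin N.n, IsCutEdge N e → ∀ f ∈ N.E.erase e, ∀ g ∈ N.E.erase e,
      Relation.ReflTransGen (uadj N (N.E.erase e)) f.1 g.1)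

/-- The non-trivial ST-set `S` is under a cut-edge of `N`: `N` has a cut-edge `(u,v)`
such that the subnetwork rooted at `v` is a tree whose taxa set is `S` and which
represents the cluster set `𝒞 | S`. -/
def UnderCutEdge (𝒞 : Set (Finset α)) (N : Net α) (S : Finset α) : Prop :=
  ∃ e ∈ N.E, IsCutEdge N e ∧ N.clusterBelow e.2 = S ∧
    (∀ w : Fin N.n, N.Reaches e.2 w →
      (N.E.filter fun f => f.2 = w ∧ N.Reaches e.2 f.1).card ≤ 1) ∧
    ∀ C ∈ restrictTo 𝒞 S, ∃ f ∈ N.E, N.Reaches e.2 f.1 ∧ N.clusterBelow f.2 = C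

/-- The subnetwork of `N` rooted at `v` is exactly (isomorphic to) `T`. -/
def IsoSubnetAt (N : Net α) (v : Fin N.n) (T : Net α) : Prop :=
  ∃ g : Fin T.n → Fin N.n, Function.Injective g ∧
    Set.range g = {w | N.Reaches v w} ∧
    (∀ a b : Fin T.n, (a, b) ∈ T.E ↔ (g a, g b) ∈ N.E) ∧
    ∀ a : Fin T.n, T.IsLeaf a → N.label (g a) = T.label a

/-- `T` is a subtree below a reticulation (SBR) of `N`. -/
def IsSBR (N T : Net α) : Prop :=
  ∃ v : Fin N.n, 2 ≤ N.indeg v ∧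
    (∀ w : Fin N.n, N.Reaches v w → w ≠ v → N.indeg w < 2) ∧
    ((N.outdeg v = 1 ∧ ∃ c : Fin N.n, (v, c) ∈ N.E ∧ IsoSubnetAt N c T) ∨
     (N.outdeg v ≠ 1 ∧ IsoSubnetAt N v T))

/-- `T'` is a (not necessarily binary) refinement of `T`: a tree on `X` with
`Cl(T) ⊆ Cl(T')`. -/
def IsRefinement (X : Finset α) (T T' : Net α) : Prop :=
  IsPhyloTree X T' ∧ clSet T ⊆ clSet T'

/-- `h⁰(𝒯)`: minimum reticulation number of a network on `X` displaying some
refinement of each tree of the family. -/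
noncomputable def h0 (X : Finset α) {m : ℕ} (T : Fin m → Net α) : ℕ :=
  sInf {k | ∃ N : Net α, IsPhyloNet X N ∧
    (∀ i, ∃ T', IsRefinement X (T i) T' ∧ Displays N T') ∧ N.reticNum = k}

/-- `h⁻(𝒯)`: minimum reticulation number of a network on `X` displaying some *binary*
refinement of each tree of the family. -/
noncomputable def hminus (X : Finset α) {m : ℕ} (T : Fin m → Net α) : ℕ :=
  sInf {k | ∃ N : Net α, IsPhyloNet X N ∧
    (∀ i, ∃ T', IsRefinement X (T i) T' ∧ IsBinary T' ∧ Displays N T') ∧ N.reticNum = k}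

/-- `N` is consistent with the rooted triplet `xy|z`: it displays the binary tree on
`{x,y,z}` in which `{x,y}` is a cluster. -/
def ConsistentTriplet (N : Net α) (x y z : α) : Prop :=
  ∃ t : Net α, IsPhyloTree ({x, y, z} : Finset α) t ∧ IsBinary t ∧
    (∃ e ∈ t.E, t.clusterBelow e.2 = ({x, y} : Finset α)) ∧ Displays N t

/-- `r_tr(𝒯)`: minimum reticulation number of a network on `X` consistent with every
rooted triplet consistent with some tree of the family. -/
noncomputable def rtr (X : Finset α) {m : ℕ} (T : Fin m → Net α) : ℕ :=
  sInf {k | ∃ N : Net α, IsPhyloNet X N ∧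
    (∀ x y z : α, x ≠ y → y ≠ z → x ≠ z →
      (∃ i, ConsistentTriplet (T i) x y z) → ConsistentTriplet N x y z) ∧
    N.reticNum = k}

/-- `𝒞_{U → u}`: replace all elements of `U` in every cluster by the single taxon `u`. -/
def collapseTo (𝒞 : Set (Finset α)) (U : Finset α) (u : α) : Set (Finset α) :=
  {D | ∃ C ∈ 𝒞, D = if (C ∩ U).Nonempty then (C \ U) ∪ {u} else C}

set_option linter.unusedSectionVars false
/-- Intermediate representation of a network given by `m` parent functions. -/
structure Pre (m : ℕ) (X : Finset α) (V : Type) where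
  root : V
  par : Fin m → V → V
  h : V → ℕ
  leaf : α → V
  lab : V → α
  cl : Fin m → V → Finset α
  h_lt : ∀ i v, v ≠ root → h (par i v) < h v
  lab_leaf : ∀ x ∈ X, lab (leaf x) = x
  leaf_ne_root : ∀ x ∈ X, leaf x ≠ root
  leaf_const : ∀ x ∈ X, ∀ i j, par i (leaf x) = par j (leaf x)
  leaf_ne_par : ∀ x ∈ X, ∀ i v, v ≠ root → par i v ≠ leaf x
  cl_leaf : ∀ x ∈ X, ∀ i, cl i (leaf x) = {x}
  cl_node : ∀ i v, (∀ x ∈ X, v ≠ leaf x) →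
    ∀ y, y ∈ cl i v ↔ ∃ u, u ≠ root ∧ par i u = v ∧ y ∈ cl i u
  child_ex : ∀ i v, (∀ x ∈ X, v ≠ leaf x) → ∃ u, u ≠ root ∧ par i u = v

namespace Pre

variable {m : ℕ} {X : Finset α} {V : Type}

def Const (P : Pre m X V) (v : V) : Prop := ∀ i j, P.par i v = P.par j v

def Child (P : Pre m X V) (v u : V) : Prop := u ≠ P.root ∧ ∃ i, P.par i u = v

def Thin (P : Pre m X V) (v : V) : Prop := v ≠ P.root ∧ P.Const v ∧ ∃! u, P.Child v u

def adj (P : Pre m X V) (i : Fin m) (a b : V) : Prop := b ≠ P.root ∧ P.par i b = a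

def Reach (P : Pre m X V) (i : Fin m) : V → V → Prop := Relation.ReflTransGen (P.adj i)

theorem exists_bound [Fintype V] (P : Pre m X V) : ∃ M, ∀ v, P.h v ≤ M :=
  ⟨Finset.univ.sup P.h, fun v => Finset.le_sup (Finset.mem_univ v)⟩

theorem down_induct [Fintype V] (P : Pre m X V) (i : Fin m) (motive : V → Prop)
    (H : ∀ v, (∀ u, u ≠ P.root → P.par i u = v → motive u) → motive v) : ∀ v, motive v := by
  obtain ⟨M, hM⟩ := P.exists_bound
  have key : ∀ k v, M - P.h v ≤ k → motive v := by
    intro k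
    induction k with
    | zero =>
      intro v hv
      apply H
      intro u hu he
      have h1 := P.h_lt i u hu
      have := hM u
      rw [he] at h1
      omega
    | succ k ih =>
      intro v hv
      apply H
      intro u hu he
      have h1 := P.h_lt i u hu
      have := hM u
      rw [he] at h1
      apply ih
      omega
  intro v
  exact key _ v le_rfl

theorem up_induct (P : Pre m X V) (i : Fin m) (motive : V → Prop)
    (H : ∀ v, (v ≠ P.root → motive (P.par i v)) → motive v) : ∀ v, motive v := by
  have key : ∀ k v, P.h v ≤ k → motive v := by
    intro k
    induction k with
    | zero =>
      intro v hv
      apply H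
      intro hv'
      have := P.h_lt i v hv'
      omega
    | succ k ih =>
      intro v hv
      apply H
      intro hv'
      have := P.h_lt i v hv'
      apply ih
      omega
  intro v
  exact key _ v le_rfl

theorem reach_h (P : Pre m X V) (i : Fin m) {a b : V} (hr : P.Reach i a b) : P.h a ≤ P.h b := by
  induction hr with
  | refl => rfl
  | tail _ h ih =>
    have := P.h_lt i _ h.1
    rw [h.2] at this
    omega

theorem reach_leaf (P : Pre m X V) (i : Fin m) {x : α} (hx : x ∈ X) {b : V}
    (hr : P.Reach i (P.leaf x) b) : b = P.leaf x := by
  rcases Relation.ReflTransGen.cases_head hr with h | ⟨c, hc, _⟩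
  · exact h.symm
  · exact absurd hc.2 (P.leaf_ne_par x hx i c hc.1)

theorem cl_iff [Fintype V] (P : Pre m X V) (i : Fin m) (v : V) (y : α) :
    y ∈ P.cl i v ↔ y ∈ X ∧ P.Reach i v (P.leaf y) := by
  revert v
  apply P.down_induct i
  intro v ih
  by_cases hv : ∃ x ∈ X, v = P.leaf x
  · obtain ⟨x, hx, rfl⟩ := hv
    rw [P.cl_leaf x hx i, Finset.mem_singleton]
    constructor
    · rintro rfl
      exact ⟨hx, Relation.ReflTransGen.refl⟩
    · rintro ⟨hy, hr⟩
      have := P.reach_leaf i hx hr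
      rw [← P.lab_leaf x hx, ← P.lab_leaf y hy, this]
  · push Not at hv
    rw [P.cl_node i v hv]
    constructor
    · rintro ⟨u, hu, he, hy⟩
      obtain ⟨h1, h2⟩ := (ih u hu he).1 hy
      exact ⟨h1, Relation.ReflTransGen.head ⟨hu, he⟩ h2⟩
    · rintro ⟨hy, hr⟩
      rcases Relation.ReflTransGen.cases_head hr with h | ⟨c, hc, h2⟩
      · exact absurd h (hv y hy)
      · exact ⟨c, hc.1, hc.2, (ih c hc.1 hc.2).2 ⟨hy, h2⟩⟩

theorem reach_root (P : Pre m X V) (i : Fin m) : ∀ v, P.Reach i P.root v := by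
  apply P.up_induct i
  intro v ih
  by_cases hv : v = P.root
  · rw [hv]; exact Relation.ReflTransGen.refl
  · exact Relation.ReflTransGen.tail (ih hv) ⟨hv, rfl⟩

theorem cl_root [Fintype V] (P : Pre m X V) (i : Fin m) : P.cl i P.root = X := by
  ext y
  rw [P.cl_iff]
  exact ⟨fun h => h.1, fun h => ⟨h, P.reach_root i _⟩⟩

theorem cl_mono [Fintype V] (P : Pre m X V) (i : Fin m) {a b : V} (h : P.Reach i a b) :
    P.cl i b ⊆ P.cl i a := by
  intro y hy
  rw [P.cl_iff] at hy ⊢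
  exact ⟨hy.1, h.trans hy.2⟩

theorem reach_total (P : Pre m X V) (i : Fin m) {a b c : V} (h1 : P.Reach i a c)
    (h2 : P.Reach i b c) : P.Reach i a b ∨ P.Reach i b a := by
  have h1' : Relation.ReflTransGen (Function.swap (P.adj i)) c a := (Relation.reflTransGen_swap).2 h1
  have h2' : Relation.ReflTransGen (Function.swap (P.adj i)) c b := (Relation.reflTransGen_swap).2 h2
  have hu : Relator.RightUnique (Function.swap (P.adj i)) := by
    intro x y z hy hz
    exact hy.2.symm.trans hz.2
  rcases Relation.ReflTransGen.total_of_right_unique hu h1' h2' with h | h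
  · right; exact (Relation.reflTransGen_swap).1 h
  · left; exact (Relation.reflTransGen_swap).1 h

theorem cl_nonempty [Fintype V] (P : Pre m X V) (i : Fin m) : ∀ v, (P.cl i v).Nonempty := by
  apply P.down_induct i
  intro v ih
  by_cases hv : ∃ x ∈ X, v = P.leaf x
  · obtain ⟨x, hx, rfl⟩ := hv
    rw [P.cl_leaf x hx i]
    exact Finset.singleton_nonempty x
  · push Not at hv
    obtain ⟨u, hu, he⟩ := P.child_ex i v hv
    obtain ⟨y, hy⟩ := ih u hu he
    exact ⟨y, (P.cl_node i v hv y).2 ⟨u, hu, he, hy⟩⟩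

/-- Subdivide the edge above `v`. -/
noncomputable def sub (P : Pre m X V) (v : V) (hv : v ≠ P.root) : Pre m X (Option V) where
  root := some P.root
  par i o := match o with
    | none => some (P.par i v)
    | some u => if u = v then none else some (P.par i u)
  h o := match o with
    | none => 2 * P.h v - 1
    | some u => 2 * P.h u
  leaf x := some (P.leaf x)
  lab o := match o with
    | none => P.lab v
    | some u => P.lab u
  cl i o := match o with
    | none => P.cl i v
    | some u => P.cl i u
  h_lt := by
    intro i o ho
    cases o with
    | none =>
      have := P.h_lt i v hv
      simp only
      omega
    | some u =>
      by_cases hu : u = v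
      · subst hu
        have := P.h_lt i u hv
        simp only [if_true]
        omega
      · have := P.h_lt i u (by simpa using ho)
        simp only [if_neg hu]
        omega
  lab_leaf := fun x hx => P.lab_leaf x hx
  leaf_ne_root := fun x hx => by simpa using P.leaf_ne_root x hx
  leaf_const := by
    intro x hx i j
    by_cases h : P.leaf x = v
    · simp [h]
    · simp [h, P.leaf_const x hx i j]
  leaf_ne_par := by
    intro x hx i o ho
    cases o with
    | none => simpa using P.leaf_ne_par x hx i v hv
    | some u =>
      by_cases hu : u = v
      · simp [hu]
      · simpa [hu] using P.leaf_ne_par x hx i u (by simpa using ho)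
  cl_leaf := fun x hx i => P.cl_leaf x hx i
  cl_node := by
    intro i o ho y
    cases o with
    | none =>
      constructor
      · intro hy
        exact ⟨some v, by simpa using hv, by simp, hy⟩
      · rintro ⟨o', h1, h2, h3⟩
        cases o' with
        | none => simp at h2
        | some u =>
          by_cases hu : u = v
          · subst hu; exact h3
          · simp [hu] at h2
    | some w =>
      have hw : ∀ x ∈ X, w ≠ P.leaf x := fun x hx => by simpa using ho x hx
      simp only
      rw [P.cl_node i w hw]
      constructor
      · rintro ⟨u, h1, h2, h3⟩
        by_cases hu : u = v
        · subst hu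
          exact ⟨none, by simp, by simp [h2], h3⟩
        · exact ⟨some u, by simpa using h1, by simp [h2, hu], h3⟩
      · rintro ⟨o', h1, h2, h3⟩
        cases o' with
        | none => exact ⟨v, hv, by simpa using h2, h3⟩
        | some u =>
          by_cases hu : u = v
          · simp [hu] at h2
          · exact ⟨u, by simpa using h1, by simpa [hu] using h2, h3⟩
  child_ex := by
    intro i o ho
    cases o with
    | none => exact ⟨some v, by simpa using hv, by simp⟩
    | some w =>
      have hw : ∀ x ∈ X, w ≠ P.leaf x := fun x hx => by simpa using ho x hx
      obtain ⟨u, h1, h2⟩ := P.child_ex i w hw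
      by_cases hu : u = v
      · subst hu
        exact ⟨none, by simp, by simp [h2]⟩
      · exact ⟨some u, by simpa using h1, by simp [h2, hu]⟩

end Pre

set_option linter.unusedSectionVars false
namespace Pre

variable {m : ℕ} {X : Finset α} {V : Type}

def IsRet (P : Pre m X V) (v : V) : Prop := v ≠ P.root ∧ ¬ P.Const v

noncomputable def nret [Fintype V] (P : Pre m X V) : ℕ :=
  (Finset.univ.filter fun v => P.IsRet v).card

section sub
variable (P : Pre m X V) (v : V) (hv : v ≠ P.root)

theorem sub_par_none (i : Fin m) : (P.sub v hv).par i none = some (P.par i v) := rfl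

theorem sub_par_self (i : Fin m) : (P.sub v hv).par i (some v) = none := by
  simp [sub]

theorem sub_par_ne (i : Fin m) {u : V} (hu : u ≠ v) :
    (P.sub v hv).par i (some u) = some (P.par i u) := by
  simp [sub, hu]

theorem sub_root : (P.sub v hv).root = some P.root := rfl

theorem sub_const_none (hc : P.Const v) : (P.sub v hv).Const none := by
  intro i j
  rw [sub_par_none, sub_par_none, hc i j]

theorem sub_const_some (hc : P.Const v) (u : V) : (P.sub v hv).Const (some u) ↔ P.Const u := by
  by_cases hu : u = v
  · subst hu
    refine ⟨fun _ => hc, fun _ i j => ?_⟩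
    rw [sub_par_self, sub_par_self]
  · constructor
    · intro h i j
      have := h i j
      rw [sub_par_ne _ _ _ _ hu, sub_par_ne _ _ _ _ hu] at this
      simpa using this
    · intro h i j
      rw [sub_par_ne _ _ _ _ hu, sub_par_ne _ _ _ _ hu, h i j]

theorem sub_child_none [NeZero m] (o : Option V) : (P.sub v hv).Child none o ↔ o = some v := by
  constructor
  · rintro ⟨h1, i, h2⟩
    cases o with
    | none => rw [sub_par_none] at h2; simp at h2
    | some u =>
      by_cases hu : u = v
      · rw [hu]
      · rw [sub_par_ne _ _ _ _ hu] at h2; simp at h2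
  · rintro rfl
    exact ⟨by rw [sub_root]; simpa using hv, 0, sub_par_self _ _ _ _⟩

theorem sub_child_some (w : V) (o : Option V) : (P.sub v hv).Child (some w) o ↔
    ∃ u, P.Child w u ∧ o = if u = v then none else some u := by
  constructor
  · rintro ⟨h1, i, h2⟩
    cases o with
    | none =>
      rw [sub_par_none] at h2
      exact ⟨v, ⟨hv, i, by simpa using h2⟩, by simp⟩
    | some u =>
      by_cases hu : u = v
      · rw [hu, sub_par_self] at h2; simp at h2
      · rw [sub_par_ne _ _ _ _ hu] at h2
        rw [sub_root] at h1
        exact ⟨u, ⟨by simpa using h1, i, by simpa using h2⟩, by simp [hu]⟩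
  · rintro ⟨u, ⟨h1, i, h2⟩, rfl⟩
    by_cases hu : u = v
    · subst hu
      simp only [if_true]
      exact ⟨by rw [sub_root]; simp, i, by rw [sub_par_none, h2]⟩
    · rw [if_neg hu]
      exact ⟨by rw [sub_root]; simpa using h1, i, by rw [sub_par_ne _ _ _ _ hu, h2]⟩

theorem sub_thin_none [NeZero m] (hc : P.Const v) : (P.sub v hv).Thin none :=
  ⟨by rw [sub_root]; simp, P.sub_const_none v hv hc, some v,
    (P.sub_child_none v hv _).2 rfl, fun o ho => (P.sub_child_none v hv o).1 ho⟩

theorem sub_thin_some (hc : P.Const v) (w : V) : (P.sub v hv).Thin (some w) ↔ P.Thin w := by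
  unfold Thin
  rw [P.sub_const_some v hv hc, sub_root]
  have : (∃! o, (P.sub v hv).Child (some w) o) ↔ ∃! u, P.Child w u := by
    constructor
    · rintro ⟨o, ho, h⟩
      obtain ⟨u, hu, rfl⟩ := (P.sub_child_some v hv w o).1 ho
      refine ⟨u, hu, fun u' hu' => ?_⟩
      have := h _ ((P.sub_child_some v hv w _).2 ⟨u', hu', rfl⟩)
      by_cases h1 : u' = v <;> by_cases h2 : u = v <;> simp_all
    · rintro ⟨u, hu, h⟩
      refine ⟨_, (P.sub_child_some v hv w _).2 ⟨u, hu, rfl⟩, fun o ho => ?_⟩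
      obtain ⟨u', hu', rfl⟩ := (P.sub_child_some v hv w o).1 ho
      rw [h u' hu']
  rw [this]
  simp

theorem sub_nret [Fintype V] (hc : P.Const v) : (P.sub v hv).nret = P.nret := by
  unfold nret
  refine Eq.trans (congrArg Finset.card ?_) (Finset.card_map Function.Embedding.some)
  ext o
  cases o with
  | none =>
    have e : ¬ (P.sub v hv).IsRet none := by
      simp [IsRet, P.sub_const_none v hv hc]
    simp [e]
  | some u =>
    have e : (P.sub v hv).IsRet (some u) ↔ P.IsRet u := by
      simp [IsRet, P.sub_const_some v hv hc, sub_root]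
    simp [e]

end sub

/-- `w` is a suitable attachment point for index `i` and cluster `D`. -/
def Good (P : Pre m X V) (i : Fin m) (D : Finset α) (w : V) : Prop :=
  w ≠ P.root ∧ P.Const w ∧ P.cl i w = D ∧
    ∃ t, t ≠ P.root ∧ P.Const t ∧ P.par i t = w ∧ P.cl i t = D

def Has (P : Pre m X V) (i : Fin m) (D : Finset α) : Prop :=
  ∃ v, v ≠ P.root ∧ P.Const v ∧ P.cl i v = D

theorem sub_has (P : Pre m X V) (v : V) (hv : v ≠ P.root) (hc : P.Const v) (i : Fin m)
    (D : Finset α) (h : P.Has i D) : (P.sub v hv).Has i D := by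
  obtain ⟨u, h1, h2, h3⟩ := h
  exact ⟨some u, by rw [sub_root]; simpa using h1, (P.sub_const_some v hv hc u).2 h2, h3⟩

theorem sub_good (P : Pre m X V) (v : V) (hv : v ≠ P.root) (hc : P.Const v) (i : Fin m)
    (D : Finset α) (w : V) (h : P.Good i D w) : (P.sub v hv).Good i D (some w) := by
  obtain ⟨h1, h2, h3, t, h4, h5, h6, h7⟩ := h
  refine ⟨by rw [sub_root]; simpa using h1, (P.sub_const_some v hv hc w).2 h2, h3, ?_⟩
  by_cases ht : t = v
  · subst ht
    exact ⟨none, by rw [sub_root]; simp, P.sub_const_none t hv hc, by rw [sub_par_none, h6], h7⟩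
  · exact ⟨some t, by rw [sub_root]; simpa using h4, (P.sub_const_some v hv hc t).2 h5,
      by rw [sub_par_ne _ _ _ _ ht, h6], h7⟩

theorem sub_good_none (P : Pre m X V) (v : V) (hv : v ≠ P.root) (hc : P.Const v) (i : Fin m)
    (D : Finset α) (h : P.cl i v = D) : (P.sub v hv).Good i D none :=
  ⟨by rw [sub_root]; simp, P.sub_const_none v hv hc, h, some v,
    by rw [sub_root]; simpa using hv, (P.sub_const_some v hv hc v).2 hc, sub_par_self _ _ _ _, h⟩

theorem exists_subdiv [NeZero m] [Fintype V] (P : Pre m X V) (hP : ∀ v, ¬ P.Thin v)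
    (D : Fin m → Finset α) (hD : ∀ i, P.Has i (D i)) (s : Finset (Fin m)) :
    ∃ (V' : Type) (_ : Fintype V') (P' : Pre m X V') (w : Fin m → V'),
      Set.InjOn w s ∧ (∀ v, P'.Thin v ↔ ∃ i ∈ s, w i = v) ∧ (∀ i ∈ s, P'.Good i (D i) (w i)) ∧
      (∀ i C, P.Has i C → P'.Has i C) ∧ P'.nret = P.nret := by
  induction s using Finset.induction_on with
  | empty =>
    exact ⟨V, inferInstance, P, fun _ => P.root, by simp, by simpa using hP, by simp,
      fun _ _ h => h, rfl⟩
  | insert j s hj ih =>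
    obtain ⟨V', _, P', w, h1, h2, h3, h4, h5⟩ := ih
    obtain ⟨v, hv, hc, hcl⟩ := h4 j _ (hD j)
    refine ⟨Option V', inferInstance, P'.sub v hv, fun i => if i = j then none else some (w i),
      ?_, ?_, ?_, ?_, ?_⟩
    · intro a ha b hb hab
      by_cases haj : a = j <;> by_cases hbj : b = j
      · rw [haj, hbj]
      · simp [haj, hbj] at hab
      · simp [haj, hbj] at hab
      · simp only [haj, hbj, if_false, Option.some.injEq] at hab
        apply h1 _ _ hab
        · simpa [haj] using ha
        · simpa [hbj] using hb
    · intro o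
      cases o with
      | none =>
        refine ⟨fun _ => ⟨j, by simp, by simp⟩, fun _ => P'.sub_thin_none v hv hc⟩
      | some u =>
        rw [P'.sub_thin_some v hv hc, h2]
        constructor
        · rintro ⟨i, hi, rfl⟩
          have : i ≠ j := fun h => hj (h ▸ hi)
          exact ⟨i, by simp [hi], by simp [this]⟩
        · rintro ⟨i, hi, h⟩
          by_cases hij : i = j
          · simp [hij] at h
          · refine ⟨i, by simpa [hij] using hi, by simpa [hij] using h⟩
    · intro i hi
      by_cases hij : i = j
      · subst hij
        simp only [if_true]
        exact P'.sub_good_none v hv hc i _ hcl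
      · simp only [hij, if_false]
        exact P'.sub_good v hv hc i _ _ (h3 i (by simpa [hij] using hi))
    · intro i C hC
      exact P'.sub_has v hv hc i C (h4 i C hC)
    · rw [P'.sub_nret v hv hc, h5]

end Pre

set_option linter.unusedSectionVars false
namespace Pre

variable {m : ℕ} {X S : Finset α} {V W : Type}

/-- Hang the tree `Q` below a new reticulation with parents `w i`. -/
noncomputable def attach [Fintype V] [Fintype W] (hS : S ⊆ X) (P : Pre m (X \ S) V)
    (Q : Pre m S W) (hQ : ∀ v, Q.Const v) (w : Fin m → V)
    (hw : ∀ i, ∀ x ∈ X \ S, w i ≠ P.leaf x) :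
    Pre m X (V ⊕ W) where
  root := Sum.inl P.root
  par i z := match z with
    | Sum.inl v => Sum.inl (P.par i v)
    | Sum.inr u => if u = Q.root then Sum.inl (w i) else Sum.inr (Q.par i u)
  h z := match z with
    | Sum.inl v => P.h v
    | Sum.inr u => Finset.univ.sup P.h + 1 + Q.h u
  leaf x := if x ∈ S then Sum.inr (Q.leaf x) else Sum.inl (P.leaf x)
  lab z := match z with
    | Sum.inl v => P.lab v
    | Sum.inr u => Q.lab u
  cl i z := match z with
    | Sum.inl v => P.cl i v ∪ (if P.Reach i v (w i) then S else ∅)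
    | Sum.inr u => Q.cl i u
  h_lt := by
    intro i z hz
    match z with
    | Sum.inl v => exact P.h_lt i v (by simpa using hz)
    | Sum.inr u =>
      by_cases hu : u = Q.root
      · have := Finset.le_sup (f := P.h) (Finset.mem_univ (w i))
        simp only [hu, if_true]
        omega
      · have := Q.h_lt i u hu
        simp only [hu, if_false]
        omega
  lab_leaf := by
    intro x hx
    by_cases h : x ∈ S
    · simp [h, Q.lab_leaf x h]
    · simp [h, P.lab_leaf x (by simp [hx, h])]
  leaf_ne_root := by
    intro x hx
    by_cases h : x ∈ S
    · simp [h]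
    · simpa [h] using P.leaf_ne_root x (by simp [hx, h])
  leaf_const := by
    intro x hx i j
    by_cases h : x ∈ S
    · simp [h, Q.leaf_ne_root x h, hQ _ i j]
    · simpa [h] using P.leaf_const x (by simp [hx, h]) i j
  leaf_ne_par := by
    intro x hx i z hz
    match z with
    | Sum.inl v =>
      by_cases h : x ∈ S
      · simp [h]
      · simpa [h] using P.leaf_ne_par x (by simp [hx, h]) i v (by simpa using hz)
    | Sum.inr u =>
      by_cases hu : u = Q.root
      · by_cases h : x ∈ S
        · simp [h, hu]
        · simpa [h, hu] using hw i x (by simp [hx, h])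
      · by_cases h : x ∈ S
        · simpa [h, hu] using Q.leaf_ne_par x h i u hu
        · simp [h, hu]
  cl_leaf := by
    intro x hx i
    by_cases h : x ∈ S
    · simp [h, Q.cl_leaf x h]
    · have hx' : x ∈ X \ S := by simp [hx, h]
      have : ¬ P.Reach i (P.leaf x) (w i) := fun hr => hw i x hx' (P.reach_leaf i hx' hr)
      simp [h, this, P.cl_leaf x hx']
  cl_node := by
    intro i z hz y
    match z with
    | Sum.inl v =>
      have hv : ∀ x ∈ X \ S, v ≠ P.leaf x := by
        intro x hx
        have := hz x (Finset.mem_sdiff.1 hx).1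
        simpa [(Finset.mem_sdiff.1 hx).2] using this
      simp only [Finset.mem_union]
      constructor
      · rintro (hy | hy)
        · obtain ⟨u, h1, h2, h3⟩ := (P.cl_node i v hv y).1 hy
          exact ⟨Sum.inl u, by simpa using h1, by simp [h2], by simp [h3]⟩
        · by_cases hr : P.Reach i v (w i)
          · rw [if_pos hr] at hy
            rcases Relation.ReflTransGen.cases_head hr with h | ⟨c, hc, h2⟩
            · exact ⟨Sum.inr Q.root, by simp, by simp [h], by simp [Q.cl_root, hy]⟩
            · refine ⟨Sum.inl c, by simpa using hc.1, by simp [hc.2], ?_⟩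
              have h2' : P.Reach i c (w i) := h2
              simp [h2', hy]
          · simp [hr] at hy
      · rintro ⟨z', h1, h2, h3⟩
        match z' with
        | Sum.inl u =>
          have h1' : u ≠ P.root := by simpa using h1
          have h2' : P.par i u = v := by simpa using h2
          rcases Finset.mem_union.1 h3 with h | h
          · left
            exact (P.cl_node i v hv y).2 ⟨u, h1', h2', h⟩
          · right
            by_cases hr : P.Reach i u (w i)
            · have hr' : P.Reach i v (w i) := Relation.ReflTransGen.head ⟨h1', h2'⟩ hr
              rw [if_pos hr] at h
              rw [if_pos hr']
              exact h
            · simp [hr] at h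
        | Sum.inr u =>
          by_cases hu : u = Q.root
          · subst hu
            simp only [if_true, Sum.inl.injEq] at h2
            right
            have hr' : P.Reach i v (w i) := by rw [h2]; exact Relation.ReflTransGen.refl
            rw [if_pos hr']
            simpa [Q.cl_root] using h3
          · simp [hu] at h2
    | Sum.inr u =>
      have hu : ∀ x ∈ S, u ≠ Q.leaf x := by
        intro x hx
        simpa [hx] using hz x (hS hx)
      simp only
      rw [Q.cl_node i u hu]
      constructor
      · rintro ⟨t, h1, h2, h3⟩
        exact ⟨Sum.inr t, by simp, by simp [h1, h2], h3⟩
      · rintro ⟨z', h1, h2, h3⟩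
        match z' with
        | Sum.inl t => simp at h2
        | Sum.inr t =>
          by_cases ht : t = Q.root
          · simp [ht] at h2
          · exact ⟨t, ht, by simpa [ht] using h2, h3⟩
  child_ex := by
    intro i z hz
    match z with
    | Sum.inl v =>
      have hv : ∀ x ∈ X \ S, v ≠ P.leaf x := by
        intro x hx
        have := hz x (Finset.mem_sdiff.1 hx).1
        simpa [(Finset.mem_sdiff.1 hx).2] using this
      obtain ⟨u, h1, h2⟩ := P.child_ex i v hv
      exact ⟨Sum.inl u, by simpa using h1, by simp [h2]⟩
    | Sum.inr u =>
      have hu : ∀ x ∈ S, u ≠ Q.leaf x := by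
        intro x hx
        simpa [hx] using hz x (hS hx)
      obtain ⟨t, h1, h2⟩ := Q.child_ex i u hu
      exact ⟨Sum.inr t, by simp, by simp [h1, h2]⟩

section attach
variable [Fintype V] [Fintype W] (hS : S ⊆ X) (P : Pre m (X \ S) V)
    (Q : Pre m S W) (hQ : ∀ v, Q.Const v) (w : Fin m → V)
    (hw : ∀ i, ∀ x ∈ X \ S, w i ≠ P.leaf x)

theorem attach_const_inl (v : V) :
    (attach hS P Q hQ w hw).Const (Sum.inl v) ↔ P.Const v := by
  simp [Const, attach]

theorem attach_const_inr (u : W) (hu : u ≠ Q.root) :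
    (attach hS P Q hQ w hw).Const (Sum.inr u) := by
  intro i j
  simp [attach, hu, hQ u i j]

theorem attach_not_const (i j : Fin m) (hij : w i ≠ w j) :
    ¬ (attach hS P Q hQ w hw).Const (Sum.inr Q.root) := by
  intro h
  have := h i j
  simp [attach] at this
  exact hij this

theorem attach_child_inl (v u : V) (h : P.Child v u) :
    (attach hS P Q hQ w hw).Child (Sum.inl v) (Sum.inl u) := by
  obtain ⟨h1, i, h2⟩ := h
  exact ⟨by simpa [attach] using h1, i, by simpa [attach] using h2⟩

theorem attach_child_root (i : Fin m) :
    (attach hS P Q hQ w hw).Child (Sum.inl (w i)) (Sum.inr Q.root) :=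
  ⟨by simp [attach], i, by simp [attach]⟩

theorem attach_child_inr (u : W) (z : V ⊕ W) :
    (attach hS P Q hQ w hw).Child (Sum.inr u) z ↔ ∃ t, Q.Child u t ∧ z = Sum.inr t := by
  constructor
  · rintro ⟨h1, i, h2⟩
    match z with
    | Sum.inl t => simp [attach] at h2
    | Sum.inr t =>
      by_cases ht : t = Q.root
      · simp [attach, ht] at h2
      · exact ⟨t, ⟨ht, i, by simpa [attach, ht] using h2⟩, rfl⟩
  · rintro ⟨t, ⟨h1, i, h2⟩, rfl⟩
    exact ⟨by simp [attach], i, by simpa [attach, h1] using h2⟩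

theorem attach_not_thin (hQt : ∀ v, ¬ Q.Thin v) (i j : Fin m) (hij : w i ≠ w j)
    (hPt : ∀ v, P.Thin v → ∃ i, w i = v)
    (hwc : ∀ i, ∃ t, P.Child (w i) t) :
    ∀ z, ¬ (attach hS P Q hQ w hw).Thin z := by
  rintro (v | u) ⟨h1, h2, t, h3, h4⟩
  · rw [attach_const_inl] at h2
    have h1' : v ≠ P.root := by simpa [attach] using h1
    by_cases hv : ∃ k, w k = v
    · obtain ⟨k, rfl⟩ := hv
      have e1 := h4 _ (attach_child_root hS P Q hQ w hw k)
      obtain ⟨s, hs⟩ := hwc k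
      have e2 := h4 _ (attach_child_inl hS P Q hQ w hw _ _ hs)
      rw [← e2] at e1
      simp at e1
    · apply hv
      apply hPt
      refine ⟨h1', h2, ?_⟩
      match t with
      | Sum.inl t =>
        obtain ⟨h5, k, h6⟩ := h3
        refine ⟨t, ⟨by simpa [attach] using h5, k, by simpa [attach] using h6⟩, ?_⟩
        intro t' ht'
        simpa using h4 _ (attach_child_inl hS P Q hQ w hw _ _ ht')
      | Sum.inr t =>
        obtain ⟨h5, k, h6⟩ := h3
        by_cases ht : t = Q.root
        · simp [attach, ht] at h6
          exact absurd ⟨k, h6⟩ hv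
        · simp [attach, ht] at h6
  · by_cases hu : u = Q.root
    · subst hu
      exact attach_not_const hS P Q hQ w hw i j hij h2
    · apply hQt u
      obtain ⟨s, hs, rfl⟩ := (attach_child_inr hS P Q hQ w hw u t).1 h3
      refine ⟨hu, hQ u, s, hs, fun s' hs' => ?_⟩
      simpa using h4 _ ((attach_child_inr hS P Q hQ w hw u _).2 ⟨s', hs', rfl⟩)

theorem attach_nret : (attach hS P Q hQ w hw).nret ≤ P.nret + 1 := by
  unfold nret
  refine le_trans (Finset.card_le_card (t := insert (Sum.inr Q.root)
    ((Finset.univ.filter fun v => P.IsRet v).map Function.Embedding.inl)) ?_) ?_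
  · intro z hz
    rw [Finset.mem_filter] at hz
    obtain ⟨-, h1, h2⟩ := hz
    match z with
    | Sum.inl v =>
      rw [attach_const_inl] at h2
      have h1' : v ≠ P.root := by simpa [attach] using h1
      have e : P.IsRet v := ⟨h1', h2⟩
      simp [e]
    | Sum.inr u =>
      by_cases hu : u = Q.root
      · simp [hu]
      · exact absurd (attach_const_inr hS P Q hQ w hw u hu) h2
  · refine le_trans (Finset.card_insert_le _ _) ?_
    rw [Finset.card_map]

end attach

end Pre

set_option linter.unusedSectionVars false

theorem Compatible.of_inter {A B : Finset α} (h : Compatible A B) {x : α} (hA : x ∈ A)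
    (hB : x ∈ B) : A ⊆ B ∨ B ⊆ A := by
  rcases h with h | h
  · have : x ∈ A ∩ B := Finset.mem_inter.2 ⟨hA, hB⟩
    rw [h] at this
    simp at this
  · exact h

theorem exists_parent (F : Finset (Finset α))
    (hne : ∀ A ∈ F, A.Nonempty) (hlam : ∀ A ∈ F, ∀ B ∈ F, Compatible A B)
    (A : Finset α) (hA : A.Nonempty) (hex : ∃ B ∈ F, A ⊂ B) :
    ∃ B ∈ F, A ⊂ B ∧ ∀ C ∈ F, A ⊂ C → B ⊆ C := by
  obtain ⟨B0, hB0, hAB0⟩ := hex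
  obtain ⟨B, hB, hmin⟩ := Finset.exists_min_image (F.filter fun B => A ⊂ B) Finset.card
    ⟨B0, by simp [hB0, hAB0]⟩
  simp only [Finset.mem_filter] at hB hmin
  refine ⟨B, hB.1, hB.2, fun C hC hAC => ?_⟩
  obtain ⟨x, hx⟩ := hA
  rcases (hlam B hB.1 C hC).of_inter (hB.2.1 hx) (hAC.1 hx) with h | h
  · exact h
  · rw [Finset.eq_of_subset_of_card_le h (hmin C ⟨hC, hAC⟩)]

namespace Pre

theorem exists_base_aux (m : ℕ) (X : Finset α) (x0 : α) (F : Finset (Finset α))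
    (hX : X ∈ F) (hsub : ∀ A ∈ F, A ⊆ X) (hne : ∀ A ∈ F, A.Nonempty)
    (hsing : ∀ x ∈ X, {x} ∈ F) (hlam : ∀ A ∈ F, ∀ B ∈ F, Compatible A B) :
    ∃ P : Pre m X (Option F), (∀ v, P.Const v) ∧ (∀ v, ¬ P.Thin v) ∧
      ∀ i, ∀ C ∈ F, P.Has i C := by
  have hp : ∀ A : F, ∃ B : Option F, (A.1 = X ∧ B = none) ∨
      (∃ B' : F, B = some B' ∧ A.1 ⊂ B'.1 ∧ ∀ C ∈ F, A.1 ⊂ C → B'.1 ⊆ C) := by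
    rintro ⟨A, hA⟩
    by_cases h : A = X
    · exact ⟨none, Or.inl ⟨h, rfl⟩⟩
    · obtain ⟨B, hB, h1, h2⟩ := exists_parent F hne hlam A (hne A hA)
        ⟨X, hX, (Finset.ssubset_iff_subset_ne.2 ⟨hsub A hA, h⟩)⟩
      exact ⟨some ⟨B, hB⟩, Or.inr ⟨⟨B, hB⟩, rfl, h1, h2⟩⟩
  choose p hp using hp
  have hpX : ∀ A : F, p A = none → A.1 = X := by
    intro A h
    rcases hp A with h1 | ⟨B, hB, _⟩
    · exact h1.1
    · rw [h] at hB; simp at hB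
  have hpX' : p ⟨X, hX⟩ = none := by
    rcases hp ⟨X, hX⟩ with h1 | ⟨B, hB, h1, _⟩
    · exact h1.2
    · exact absurd (h1.trans_subset (hsub B.1 B.2)) (ssubset_irrefl _)
  have hpB : ∀ A B : F, p A = some B → A.1 ⊂ B.1 ∧ ∀ C ∈ F, A.1 ⊂ C → B.1 ⊆ C := by
    intro A B h
    rcases hp A with h1 | ⟨B', hB, h1⟩
    · rw [h] at h1; simp at h1
    · rw [h] at hB
      simp only [Option.some.injEq] at hB
      subst hB
      exact h1
  have hchild : ∀ A : F, (∀ x ∈ X, A.1 ≠ {x}) → ∀ y ∈ A.1, ∃ B : F, p B = some A ∧ y ∈ B.1 := by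
    rintro ⟨A, hA⟩ hns y hy
    have hyX : y ∈ X := hsub A hA hy
    have hyA : {y} ⊂ A := by
      rw [Finset.ssubset_iff_subset_ne]
      exact ⟨by simpa using hy, fun h => hns y hyX h.symm⟩
    obtain ⟨B, hB, hmax⟩ := Finset.exists_max_image (F.filter fun B => B ⊂ A ∧ y ∈ B) Finset.card
      ⟨{y}, by simp only [Finset.mem_filter]; exact ⟨hsing y hyX, hyA, by simp⟩⟩
    simp only [Finset.mem_filter] at hB hmax
    refine ⟨⟨B, hB.1⟩, ?_, hB.2.2⟩
    rcases hp ⟨B, hB.1⟩ with h1 | ⟨B', hB', h1, h2⟩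
    · have h3 : B = X := h1.1
      exact absurd (hB.2.1.trans_subset (hsub A hA)) (by rw [h3]; exact ssubset_irrefl _)
    · rw [hB']
      have h3 := h2 A hA hB.2.1
      congr 1
      apply Subtype.ext
      by_contra hne'
      have h4 := hmax B'.1 ⟨B'.2, Finset.ssubset_iff_subset_ne.2 ⟨h3, hne'⟩, h1.1 hB.2.2⟩
      have h5 := Finset.card_lt_card h1
      simp only at h5
      omega
  let P : Pre m X (Option F) :=
    { root := none
      par := fun _ o => match o with
        | none => none
        | some A => p A
      h := fun o => match o with
        | none => 0
        | some A => 1 + (X.card - A.1.card)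
      leaf := fun x => if hx : x ∈ X then some ⟨{x}, hsing x hx⟩ else none
      lab := fun o => match o with
        | none => x0
        | some A => (hne A.1 A.2).choose
      cl := fun _ o => match o with
        | none => X
        | some A => A.1
      h_lt := by
        intro i o ho
        match o with
        | none => exact absurd rfl ho
        | some A =>
          simp only
          cases hA : p A with
          | none => simp only; omega
          | some B =>
            have h1 := Finset.card_lt_card (hpB A B hA).1
            have h2 := Finset.card_le_card (hsub B.1 B.2)
            simp only
            omega
      lab_leaf := by
        intro x hx
        simp only [hx, dif_pos]
        have := (hne {x} (hsing x hx)).choose_spec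
        exact Finset.mem_singleton.1 this
      leaf_ne_root := by
        intro x hx
        simp [hx]
      leaf_const := fun _ _ _ _ => rfl
      leaf_ne_par := by
        intro x hx i o ho
        match o with
        | none => exact absurd rfl ho
        | some A =>
          simp only [hx, dif_pos]
          intro h
          have h1 := (hpB A _ h).1
          have h2 := Finset.card_lt_card h1
          have h3 := Finset.card_pos.2 (hne A.1 A.2)
          simp only [Finset.card_singleton] at h2
          omega
      cl_leaf := by
        intro x hx i
        simp [hx]
      cl_node := by
        intro i o ho y
        match o with
        | none =>
          constructor
          · intro hy
            exact ⟨some ⟨X, hX⟩, by simp, hpX', hy⟩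
          · rintro ⟨o', h1, h2, h3⟩
            match o' with
            | none => exact absurd rfl h1
            | some A => exact hsub A.1 A.2 h3
        | some A =>
          have hA : ∀ x ∈ X, A.1 ≠ {x} := by
            intro x hx h
            apply ho x hx
            simp only [hx, dif_pos]
            congr 1
            exact Subtype.ext h
          constructor
          · intro hy
            obtain ⟨B, hB, hyB⟩ := hchild A hA y hy
            exact ⟨some B, by simp, hB, hyB⟩
          · rintro ⟨o', h1, h2, h3⟩
            match o' with
            | none => exact absurd rfl h1
            | some B => exact (hpB B A h2).1.1 h3
      child_ex := by
        intro i o ho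
        match o with
        | none => exact ⟨some ⟨X, hX⟩, by simp, hpX'⟩
        | some A =>
          have hA : ∀ x ∈ X, A.1 ≠ {x} := by
            intro x hx h
            apply ho x hx
            simp only [hx, dif_pos]
            congr 1
            exact Subtype.ext h
          obtain ⟨y, hy⟩ := hne A.1 A.2
          obtain ⟨B, hB, hyB⟩ := hchild A hA y hy
          exact ⟨some B, by simp, hB⟩ }
  refine ⟨P, fun v i j => rfl, ?_, ?_⟩
  · rintro o ⟨h1, -, u, ⟨h3, i, h3'⟩, h4⟩
    match o with
    | none => exact h1 rfl
    | some A =>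
      match u with
      | none => exact h3 rfl
      | some B =>
        have hB : p B = some A := h3'
        have hBA := (hpB B A hB).1
        by_cases hA : ∀ x ∈ X, A.1 ≠ {x}
        · apply hBA.2
          intro y hy
          obtain ⟨B', hB', hyB'⟩ := hchild A hA y hy
          have h5 : P.Child (some A) (some B') := ⟨by simp [P], i, hB'⟩
          have h6 := h4 _ h5
          simp only [Option.some.injEq] at h6
          rw [← h6]
          exact hyB'
        · push Not at hA
          obtain ⟨x, hx, hA⟩ := hA
          have h2 := Finset.card_lt_card hBA
          have h3 := Finset.card_pos.2 (hne B.1 B.2)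
          rw [hA, Finset.card_singleton] at h2
          omega
  · intro i C hC
    exact ⟨some ⟨C, hC⟩, by simp [P], fun i j => rfl, rfl⟩

theorem exists_base (m : ℕ) (X : Finset α) (hX : X.Nonempty) (𝒞 : Set (Finset α))
    (h1 : ∀ C ∈ 𝒞, C ⊆ X ∧ C.Nonempty) (h2 : PairwiseCompatible 𝒞) :
    ∃ (V : Type) (_ : Fintype V) (P : Pre m X V), (∀ v, P.Const v) ∧ (∀ v, ¬ P.Thin v) ∧
      ∀ i C, (C ∈ 𝒞 ∨ C = X) → P.Has i C := by
  obtain ⟨x0, hx0⟩ := hX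
  let F : Finset (Finset α) := X.powerset.filter fun A => A ∈ 𝒞 ∨ A = X ∨ ∃ x ∈ X, A = {x}
  have hF : ∀ A, A ∈ F ↔ A ⊆ X ∧ (A ∈ 𝒞 ∨ A = X ∨ ∃ x ∈ X, A = {x}) := by
    intro A; simp [F]
  have hs : ∀ (x : α) (B : Finset α), Compatible {x} B := by
    intro x B
    by_cases h : x ∈ B
    · right; left; simpa using h
    · left; exact Finset.singleton_inter_of_notMem h
  have hsymm : ∀ A B : Finset α, Compatible A B → Compatible B A := by
    rintro A B (h | h | h)
    · left; rw [Finset.inter_comm]; exact h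
    · right; right; exact h
    · right; left; exact h
  obtain ⟨P, hP1, hP2, hP3⟩ := exists_base_aux m X x0 F
    ((hF X).2 ⟨subset_rfl, by simp⟩) (fun A hA => ((hF A).1 hA).1)
    (by
      intro A hA
      rcases ((hF A).1 hA).2 with h | rfl | ⟨x, _, rfl⟩
      · exact (h1 A h).2
      · exact ⟨x0, hx0⟩
      · simp)
    (by
      intro x hx
      exact (hF _).2 ⟨by simpa using hx, Or.inr (Or.inr ⟨x, hx, rfl⟩)⟩)
    (by
      intro A hA B hB
      obtain ⟨hA1, hA2⟩ := (hF A).1 hA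
      obtain ⟨hB1, hB2⟩ := (hF B).1 hB
      rcases hA2 with h | rfl | ⟨x, _, rfl⟩
      · rcases hB2 with h' | rfl | ⟨x, _, rfl⟩
        · exact h2 A h B h'
        · exact Or.inr (Or.inl hA1)
        · exact hsymm _ _ (hs x A)
      · exact Or.inr (Or.inr hB1)
      · exact hs x B)
  refine ⟨Option F, inferInstance, P, hP1, hP2, ?_⟩
  rintro i C (h | rfl)
  · exact hP3 i C ((hF C).2 ⟨(h1 C h).1, Or.inl h⟩)
  · exact hP3 i C ((hF C).2 ⟨subset_rfl, by simp⟩)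

end Pre

set_option linter.unusedSectionVars false
namespace Pre

theorem exists_step {m : ℕ} (hm : 2 ≤ m) (X S : Finset α) (hS : S ⊆ X) (hSne : S.Nonempty)
    (hXS : (X \ S).Nonempty) (𝒞 : Fin m → Set (Finset α))
    (h1 : ∀ i, ∀ C ∈ 𝒞 i, C ⊆ X ∧ C.Nonempty) (h2 : ∀ i, PairwiseCompatible (𝒞 i))
    (hst : IsSTSet X (⋃ i, 𝒞 i) S) {V : Type} [Fintype V] (P0 : Pre m (X \ S) V)
    (hP0 : ∀ v, ¬ P0.Thin v)
    (hH0 : ∀ i C, (C ∈ removeTaxa (𝒞 i) S ∨ C = X \ S) → P0.Has i C) :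
    ∃ (V' : Type) (_ : Fintype V') (P : Pre m X V'), (∀ v, ¬ P.Thin v) ∧
      P.nret ≤ P0.nret + 1 ∧ ∀ i C, (C ∈ 𝒞 i ∨ C = X) → P.Has i C := by
  haveI : NeZero m := ⟨by omega⟩
  have h1' : ∀ i C, (C ∈ 𝒞 i ∨ C = X) → C ⊆ X ∧ C.Nonempty := by
    rintro i C (h | rfl)
    · exact h1 i C h
    · exact ⟨subset_rfl, hSne.mono hS⟩
  have h2' : ∀ i A B, (A ∈ 𝒞 i ∨ A = X) → (B ∈ 𝒞 i ∨ B = X) → Compatible A B := by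
    rintro i A B (hA | rfl) hB
    · rcases hB with hB | rfl
      · exact h2 i A hA B hB
      · exact Or.inr (Or.inl (h1 i A hA).1)
    · exact Or.inr (Or.inr (h1' i B hB).1)
  have h3 : ∀ i C, (C ∈ 𝒞 i ∨ C = X) → Compatible C S := by
    rintro i C (h | rfl)
    · exact hst.2.1 C (Set.mem_iUnion.2 ⟨i, h⟩)
    · exact Or.inr (Or.inr hS)
  have hSX : S ⊂ X := by
    refine Finset.ssubset_iff_subset_ne.2 ⟨hS, ?_⟩
    rintro rfl
    simp at hXS
  -- minimal strict superset
  have hC0 : ∀ i, ∃ C, (C ∈ 𝒞 i ∨ C = X) ∧ S ⊂ C ∧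
      ∀ B, (B ∈ 𝒞 i ∨ B = X) → S ⊂ B → C ⊆ B := by
    intro i
    have hF : ∀ A, A ∈ X.powerset.filter (fun A => A ∈ 𝒞 i ∨ A = X) ↔ (A ∈ 𝒞 i ∨ A = X) := by
      intro A
      simp only [Finset.mem_filter, Finset.mem_powerset]
      exact ⟨fun h => h.2, fun h => ⟨(h1' i A h).1, h⟩⟩
    obtain ⟨B, hB, hB1, hB2⟩ := exists_parent (X.powerset.filter (fun A => A ∈ 𝒞 i ∨ A = X))
      (fun A hA => (h1' i A ((hF A).1 hA)).2)
      (fun A hA B hB => h2' i A B ((hF A).1 hA) ((hF B).1 hB)) S hSne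
      ⟨X, (hF X).2 (Or.inr rfl), hSX⟩
    exact ⟨B, (hF B).1 hB, hB1, fun C hC hC' => hB2 C ((hF C).2 hC) hC'⟩
  choose C0 hC0 hC0S hC0min using hC0
  have hrem : ∀ i C, (C ∈ 𝒞 i ∨ C = X) → (C \ S).Nonempty → P0.Has i (C \ S) := by
    rintro i C (h | rfl) hne
    · exact hH0 i _ (Or.inl ⟨hne, C, h, rfl⟩)
    · exact hH0 i _ (Or.inr rfl)
  have hDne : ∀ i, (C0 i \ S).Nonempty := fun i => Finset.sdiff_nonempty.2 (hC0S i).2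
  obtain ⟨V1, _, P, w, hwinj, hthin, hgood, hhas, hnret⟩ :=
    P0.exists_subdiv hP0 (fun i => C0 i \ S) (fun i => hrem i _ (hC0 i) (hDne i)) Finset.univ
  -- the tree on S
  obtain ⟨W, _, Q, hQ1, hQ2, hQ3⟩ := exists_base m S hSne (restrictTo (⋃ i, 𝒞 i) S)
    (by
      rintro D ⟨hD, C, hC, rfl⟩
      exact ⟨Finset.inter_subset_right, hD⟩) hst.2.2
  have hw : ∀ i, ∀ x ∈ X \ S, w i ≠ P.leaf x := by
    intro i x hx h
    obtain ⟨_, _, _, t, ht, _, htp, _⟩ := hgood i (Finset.mem_univ i)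
    exact P.leaf_ne_par x hx i t ht (htp.trans h)
  refine ⟨V1 ⊕ W, inferInstance, attach hS P Q hQ1 w hw, ?_, ?_, ?_⟩
  · apply attach_not_thin hS P Q hQ1 w hw hQ2 ⟨0, by omega⟩ ⟨1, by omega⟩
    · intro h
      have := hwinj (by simp) (by simp) h
      simp at this
    · intro v hv
      obtain ⟨i, _, h⟩ := (hthin v).1 hv
      exact ⟨i, h⟩
    · intro i
      obtain ⟨_, _, _, t, ht, _, htp, _⟩ := hgood i (Finset.mem_univ i)
      exact ⟨t, ht, i, htp⟩
  · rw [← hnret]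
    exact attach_nret hS P Q hQ1 w hw
  · intro i C hC
    obtain ⟨hw1, hw2, hw3, t, ht1, ht2, ht3, ht4⟩ := hgood i (Finset.mem_univ i)
    have hinl : ∀ v, v ≠ P.root → P.Const v →
        P.cl i v ∪ (if P.Reach i v (w i) then S else ∅) = C →
        (attach hS P Q hQ1 w hw).Has i C := by
      intro v hv hc hcl
      exact ⟨Sum.inl v, by simpa [attach] using hv,
        (attach_const_inl hS P Q hQ1 w hw v).2 hc, hcl⟩
    by_cases hCS : C ⊆ S
    · obtain ⟨u, hu1, hu2, hu3⟩ : Q.Has i C := by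
        apply hQ3
        rcases hC with hC' | hC'
        · left
          exact ⟨(h1 i C hC').2, C, Set.mem_iUnion.2 ⟨i, hC'⟩, (Finset.inter_eq_left.2 hCS).symm⟩
        · exact absurd (hC' ▸ hCS) hSX.2
      exact ⟨Sum.inr u, by simp [attach], attach_const_inr hS P Q hQ1 w hw u hu1, hu3⟩
    · rcases h3 i C hC with h | h | h
      · -- disjoint
        have hdis : C \ S = C := by
          rw [Finset.sdiff_eq_self_iff_disjoint]
          exact Finset.disjoint_iff_inter_eq_empty.2 h
        by_cases hCD : C = C0 i \ S
        · apply hinl t ht1 ht2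
          have : ¬ P.Reach i t (w i) := by
            intro hr
            have e1 := P.reach_h i hr
            have e2 := P.h_lt i t ht1
            rw [ht3] at e2
            omega
          rw [if_neg this, Finset.union_empty, ht4, hCD]
        · obtain ⟨v, hv1, hv2, hv3⟩ := hhas i _ (hrem i C hC (by rw [hdis]; exact (h1' i C hC).2))
          rw [hdis] at hv3
          apply hinl v hv1 hv2
          have : ¬ P.Reach i v (w i) := by
            intro hr
            apply hCD
            have e1 := P.cl_mono i hr
            rw [hv3, hw3] at e1
            apply Finset.Subset.antisymm _ e1
            obtain ⟨y, hy⟩ := hDne i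
            rcases (h2' i C (C0 i) hC (hC0 i)).of_inter (e1 hy) (Finset.mem_sdiff.1 hy).1 with e | e
            · intro z hz
              refine Finset.mem_sdiff.2 ⟨e hz, fun hzS => ?_⟩
              have : z ∈ C ∩ S := Finset.mem_inter.2 ⟨hz, hzS⟩
              rw [h] at this
              simp at this
            · exfalso
              obtain ⟨s, hs⟩ := hSne
              have : s ∈ C ∩ S := Finset.mem_inter.2 ⟨e ((hC0S i).1 hs), hs⟩
              rw [h] at this
              simp at this
          rw [if_neg this, Finset.union_empty, hv3]
      · exact absurd h hCS
      · have hSC : S ⊂ C := ⟨h, hCS⟩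
        have hmin := hC0min i C hC hSC
        by_cases hCC : C = C0 i
        · apply hinl (w i) hw1 hw2
          have : P.Reach i (w i) (w i) := Relation.ReflTransGen.refl
          rw [if_pos this, hw3, hCC]
          exact Finset.sdiff_union_of_subset (hC0S i).1
        · obtain ⟨v, hv1, hv2, hv3⟩ := hhas i _ (hrem i C hC (Finset.sdiff_nonempty.2 hCS))
          apply hinl v hv1 hv2
          have : P.Reach i v (w i) := by
            obtain ⟨y, hy⟩ := hDne i
            have e1 : y ∈ P.cl i (w i) := by rw [hw3]; exact hy
            have e2 : y ∈ P.cl i v := by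
              rw [hv3]; exact Finset.sdiff_subset_sdiff hmin subset_rfl hy
            rcases P.reach_total i ((P.cl_iff i v y).1 e2).2 ((P.cl_iff i (w i) y).1 e1).2 with e | e
            · exact e
            · exfalso
              apply hCC
              have e3 := P.cl_mono i e
              rw [hv3, hw3] at e3
              apply Finset.Subset.antisymm _ hmin
              intro z hz
              by_cases hzS : z ∈ S
              · exact (hC0S i).1 hzS
              · exact (Finset.mem_sdiff.1 (e3 (Finset.mem_sdiff.2 ⟨hz, hzS⟩))).1
          rw [if_pos this, hv3]
          exact Finset.sdiff_union_of_subset h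

theorem exists_main {m : ℕ} (hm : 2 ≤ m) (L : List (Finset α)) :
    ∀ (X : Finset α) (𝒞 : Fin m → Set (Finset α)), X.Nonempty →
    (∀ i, ∀ C ∈ 𝒞 i, C ⊆ X ∧ C.Nonempty) → (∀ i, PairwiseCompatible (𝒞 i)) →
    IsSTTreeSeq X (⋃ i, 𝒞 i) L →
    ∃ (V : Type) (_ : Fintype V) (P : Pre m X V), (∀ v, ¬ P.Thin v) ∧
      P.nret ≤ L.length ∧ ∀ i C, (C ∈ 𝒞 i ∨ C = X) → P.Has i C := by
  have base : ∀ (X : Finset α) (𝒞 : Fin m → Set (Finset α)), X.Nonempty →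
    (∀ i, ∀ C ∈ 𝒞 i, C ⊆ X ∧ C.Nonempty) → PairwiseCompatible (⋃ i, 𝒞 i) →
    ∃ (V : Type) (_ : Fintype V) (P : Pre m X V), (∀ v, ¬ P.Thin v) ∧
      P.nret = 0 ∧ ∀ i C, (C ∈ 𝒞 i ∨ C = X) → P.Has i C := by
    intro X 𝒞 hX h1 h2
    obtain ⟨V, _, P, hP1, hP2, hP3⟩ := exists_base m X hX (⋃ i, 𝒞 i)
      (by
        intro C hC
        obtain ⟨i, hi⟩ := Set.mem_iUnion.1 hC
        exact h1 i C hi) h2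
    refine ⟨V, inferInstance, P, hP2, ?_, ?_⟩
    · unfold nret
      rw [Finset.card_eq_zero, Finset.filter_eq_empty_iff]
      intro v _ h
      exact h.2 (hP1 v)
    · rintro i C (h | h)
      · exact hP3 i C (Or.inl (Set.mem_iUnion.2 ⟨i, h⟩))
      · exact hP3 i C (Or.inr h)
  induction L with
  | nil =>
    intro X 𝒞 hX h1 h2 hL
    obtain ⟨V, _, P, hP1, hP2, hP3⟩ := base X 𝒞 hX h1 hL.2
    exact ⟨V, inferInstance, P, hP1, by simp [hP2], hP3⟩
  | cons S L ih =>
    intro X 𝒞 hX h1 h2 hL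
    obtain ⟨⟨hst, hL1⟩, hL2⟩ := hL
    by_cases hXS : (X \ S).Nonempty
    · have hun : removeTaxa (⋃ i, 𝒞 i) S = ⋃ i, removeTaxa (𝒞 i) S := by
        ext D
        simp only [removeTaxa, Set.mem_iUnion, Set.mem_setOf_eq]
        constructor
        · rintro ⟨hD, C, ⟨i, hi⟩, hC⟩
          exact ⟨i, hD, C, hi, hC⟩
        · rintro ⟨i, hD, C, hi, hC⟩
          exact ⟨hD, C, ⟨i, hi⟩, hC⟩
      have hL2' : PairwiseCompatible (removeAll (removeTaxa (⋃ i, 𝒞 i) S) L) := hL2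
      rw [hun] at hL1 hL2'
      obtain ⟨V, _, P, hP1, hP2, hP3⟩ := ih (X \ S) (fun i => removeTaxa (𝒞 i) S) hXS
        (by
          rintro i D ⟨hD, C, hC, rfl⟩
          exact ⟨Finset.sdiff_subset_sdiff (h1 i C hC).1 subset_rfl, hD⟩)
        (by
          rintro i A ⟨hA, C, hC, rfl⟩ B ⟨hB, C', hC', rfl⟩
          rcases h2 i C hC C' hC' with h | h | h
          · left
            ext z
            have : z ∉ C ∩ C' := by rw [h]; simp
            simp only [Finset.mem_inter, Finset.mem_sdiff, Finset.notMem_empty, iff_false] at this ⊢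
            tauto
          · exact Or.inr (Or.inl (Finset.sdiff_subset_sdiff h subset_rfl))
          · exact Or.inr (Or.inr (Finset.sdiff_subset_sdiff h subset_rfl)))
        ⟨hL1, hL2'⟩
      by_cases hSne : S.Nonempty
      · obtain ⟨V', _, P', hP1', hP2', hP3'⟩ :=
          exists_step hm X S hst.1 hSne hXS 𝒞 h1 h2 hst P hP1 hP3
        refine ⟨V', inferInstance, P', hP1', ?_, hP3'⟩
        simp only [List.length_cons]
        omega
      · rw [Finset.not_nonempty_iff_eq_empty] at hSne
        subst hSne
        have hXe : X \ ∅ = X := Finset.sdiff_empty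
        revert P
        rw [hXe]
        intro P hP1 hP2 hP3
        refine ⟨V, inferInstance, P, hP1, ?_, ?_⟩
        · simp only [List.length_cons]
          omega
        · rintro i C (h | h)
          · exact hP3 i C (Or.inl ⟨(h1 i C h).2, C, h, by simp⟩)
          · exact hP3 i C (Or.inr h)
    · have hXS' : X ⊆ S := by simpa using hXS
      have hSX : S = X := Finset.Subset.antisymm hst.1 hXS'
      subst hSX
      obtain ⟨V, _, P, hP1, hP2, hP3⟩ := base S 𝒞 hX h1 (by
        have : ∀ C ∈ ⋃ i, 𝒞 i, C ∈ restrictTo (⋃ i, 𝒞 i) S := by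
          intro C hC
          obtain ⟨i, hi⟩ := Set.mem_iUnion.1 hC
          exact ⟨(h1 i C hi).2, C, hC, (Finset.inter_eq_left.2 (h1 i C hi).1).symm⟩
        intro A hA B hB
        exact hst.2.2 A (this A hA) B (this B hB))
      exact ⟨V, inferInstance, P, hP1, by omega, hP3⟩

end Pre

set_option linter.unusedSectionVars false
namespace Pre

variable {m : ℕ} {X : Finset α} {V : Type} [Fintype V]

noncomputable def net (P : Pre m X V) : Net α where
  n := Fintype.card V
  E := Finset.univ.filter fun p =>
    P.Child ((Fintype.equivFin V).symm p.1) ((Fintype.equivFin V).symm p.2)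
  label k := P.lab ((Fintype.equivFin V).symm k)

noncomputable def eq (P : Pre m X V) : V ≃ Fin P.net.n := Fintype.equivFin V

theorem mem_E (P : Pre m X V) (p : Fin P.net.n × Fin P.net.n) :
    p ∈ P.net.E ↔ P.Child (P.eq.symm p.1) (P.eq.symm p.2) :=
  ⟨fun h => (Finset.mem_filter.1 h).2, fun h => Finset.mem_filter.2 ⟨Finset.mem_univ _, h⟩⟩

theorem net_adj (P : Pre m X V) (a b : V) : P.net.Adj (P.eq a) (P.eq b) ↔ P.Child a b := by
  unfold Net.Adj
  rw [mem_E]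
  simp

theorem net_label (P : Pre m X V) (a : V) : P.net.label (P.eq a) = P.lab a :=
  congrArg P.lab (P.eq.symm_apply_apply a)

theorem net_indeg (P : Pre m X V) (v : V) :
    P.net.indeg (P.eq v) = (Finset.univ.filter fun u => P.Child u v).card := by
  unfold Net.indeg
  refine Eq.trans (congrArg Finset.card ?_) (Finset.card_map ⟨fun u => (P.eq u, P.eq v), fun a b h => by simpa using h⟩)
  ext ⟨a, b⟩
  rw [Finset.mem_filter, mem_E, Finset.mem_map]
  simp only [Finset.mem_filter, Finset.mem_univ, true_and]
  constructor
  · rintro ⟨h1, h2⟩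
    refine ⟨P.eq.symm a, ?_, Prod.ext (P.eq.apply_symm_apply a) h2.symm⟩
    rw [h2] at h1
    simpa using h1
  · rintro ⟨u, hu, h⟩
    obtain ⟨rfl, rfl⟩ := Prod.mk.inj h
    simpa using hu

theorem net_outdeg (P : Pre m X V) (v : V) :
    P.net.outdeg (P.eq v) = (Finset.univ.filter fun u => P.Child v u).card := by
  unfold Net.outdeg
  refine Eq.trans (congrArg Finset.card ?_) (Finset.card_map ⟨fun u => (P.eq v, P.eq u), fun a b h => by simpa using h⟩)
  ext ⟨a, b⟩
  rw [Finset.mem_filter, mem_E, Finset.mem_map]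
  simp only [Finset.mem_filter, Finset.mem_univ, true_and]
  constructor
  · rintro ⟨h1, h2⟩
    refine ⟨P.eq.symm b, ?_, Prod.ext h2.symm (P.eq.apply_symm_apply b)⟩
    rw [h2] at h1
    simpa using h1
  · rintro ⟨u, hu, h⟩
    obtain ⟨rfl, rfl⟩ := Prod.mk.inj h
    simpa using hu

theorem indeg_root (P : Pre m X V) : P.net.indeg (P.eq P.root) = 0 := by
  rw [net_indeg, Finset.card_eq_zero, Finset.filter_eq_empty_iff]
  intro u _ h
  exact h.1 rfl

theorem indeg_image (P : Pre m X V) (v : V) (hv : v ≠ P.root) :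
    P.net.indeg (P.eq v) = (Finset.univ.image fun i => P.par i v).card := by
  rw [net_indeg]
  congr 1
  ext u
  simp [Child, hv]

theorem indeg_pos [NeZero m] (P : Pre m X V) (v : V) (hv : v ≠ P.root) :
    1 ≤ P.net.indeg (P.eq v) := by
  rw [P.indeg_image v hv]
  exact Finset.card_pos.2 ⟨P.par 0 v, by simp⟩

theorem indeg_le (P : Pre m X V) (v : V) (hv : v ≠ P.root) :
    P.net.indeg (P.eq v) ≤ m := by
  rw [P.indeg_image v hv]
  refine le_trans Finset.card_image_le ?_
  simp

theorem indeg_le_one (P : Pre m X V) (v : V) (hv : v ≠ P.root) :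
    P.net.indeg (P.eq v) ≤ 1 ↔ P.Const v := by
  rw [P.indeg_image v hv, Finset.card_le_one]
  simp only [Finset.mem_image, Finset.mem_univ, true_and]
  constructor
  · intro h i j
    exact h _ ⟨i, rfl⟩ _ ⟨j, rfl⟩
  · rintro h _ ⟨i, rfl⟩ _ ⟨j, rfl⟩
    exact h i j

theorem isLeaf_iff [NeZero m] (P : Pre m X V) (v : V) :
    P.net.IsLeaf (P.eq v) ↔ ∃ x ∈ X, v = P.leaf x := by
  unfold Net.IsLeaf
  rw [net_outdeg, Finset.card_eq_zero, Finset.filter_eq_empty_iff]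
  constructor
  · intro h
    by_contra hc
    push Not at hc
    obtain ⟨u, h1, h2⟩ := P.child_ex 0 v hc
    exact h (Finset.mem_univ u) ⟨h1, 0, h2⟩
  · rintro ⟨x, hx, rfl⟩ u _ ⟨h1, i, h2⟩
    exact P.leaf_ne_par x hx i u h1 h2

theorem outdeg_one (P : Pre m X V) (v : V) (h : P.net.outdeg (P.eq v) = 1) :
    ∃! u, P.Child v u := by
  rw [net_outdeg, Finset.card_eq_one] at h
  obtain ⟨u, hu⟩ := h
  have : ∀ t, P.Child v t ↔ t = u := by
    intro t
    have : t ∈ (Finset.univ.filter fun u => P.Child v u) ↔ t = u := by rw [hu]; simp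
    simpa using this
  exact ⟨u, (this u).2 rfl, fun t ht => (this t).1 ht⟩

theorem isPhyloNet [NeZero m] (P : Pre m X V) (hP : ∀ v, ¬ P.Thin v) : IsPhyloNet X P.net := by
  refine ⟨?_, ?_, ?_, ?_, ?_⟩
  · intro v hv
    have : ∀ a b, Relation.TransGen P.net.Adj a b → P.h (P.eq.symm a) < P.h (P.eq.symm b) := by
      intro a b hab
      have h1 : ∀ a b, P.net.Adj a b → P.h (P.eq.symm a) < P.h (P.eq.symm b) := by
        intro a b h
        obtain ⟨h1, i, h2⟩ := (P.mem_E (a, b)).1 h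
        rw [← h2]
        exact P.h_lt i _ h1
      induction hab with
      | single h => exact h1 _ _ h
      | tail _ h ih => exact ih.trans (h1 _ _ h)
    exact lt_irrefl _ (this v v hv)
  · refine ⟨P.eq P.root, P.indeg_root, ?_⟩
    intro k hk
    obtain ⟨v, rfl⟩ := P.eq.surjective k
    by_contra hne
    have := P.indeg_pos v (fun h => hne (by rw [h]))
    have hk' : P.net.indeg (P.eq v) = 0 := hk
    omega
  · intro k hk
    obtain ⟨v, rfl⟩ := P.eq.surjective k
    have hv : v ≠ P.root := by
      rintro rfl
      rw [P.indeg_root] at hk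
      omega
    exact hP v ⟨hv, (P.indeg_le_one v hv).1 hk.1.le, P.outdeg_one v hk.2⟩
  · intro k hk
    obtain ⟨v, rfl⟩ := P.eq.surjective k
    by_contra hlt
    have h0 : P.net.IsLeaf (P.eq v) := by unfold Net.IsLeaf; omega
    obtain ⟨x, hx, rfl⟩ := (P.isLeaf_iff v).1 h0
    have := (P.indeg_le_one _ (P.leaf_ne_root x hx)).2 (P.leaf_const x hx)
    omega
  · refine ⟨?_, ?_, ?_⟩
    · intro k hk
      obtain ⟨v, rfl⟩ := P.eq.surjective k
      obtain ⟨x, hx, rfl⟩ := (P.isLeaf_iff v).1 hk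
      rw [net_label, P.lab_leaf x hx]
      exact hx
    · intro k hk k' hk' h
      obtain ⟨v, rfl⟩ := P.eq.surjective k
      obtain ⟨v', rfl⟩ := P.eq.surjective k'
      obtain ⟨x, hx, rfl⟩ := (P.isLeaf_iff v).1 hk
      obtain ⟨x', hx', rfl⟩ := (P.isLeaf_iff v').1 hk'
      rw [net_label, net_label, P.lab_leaf x hx, P.lab_leaf x' hx'] at h
      rw [h]
    · intro x hx
      exact ⟨P.eq (P.leaf x), (P.isLeaf_iff _).2 ⟨x, hx, rfl⟩, by
        rw [net_label, P.lab_leaf x hx]⟩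

theorem reticNum_le (P : Pre m X V) : P.net.reticNum ≤ (m - 1) * P.nret := by
  unfold Net.reticNum nret
  rw [← Equiv.sum_comp P.eq, mul_comm, ← smul_eq_mul, ← Finset.sum_const, Finset.sum_filter]
  apply Finset.sum_le_sum
  intro v _
  by_cases hv : v = P.root
  · rw [hv, P.indeg_root]
    simp
  · by_cases hc : P.IsRet v
    · rw [if_pos hc]
      have := P.indeg_le v hv
      omega
    · rw [if_neg hc]
      have hc' : P.Const v := by
        by_contra h
        exact hc ⟨hv, h⟩
      have := (P.indeg_le_one v hv).2 hc'
      omega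

theorem isPhyloTree (P : Pre 1 X V) (hP : ∀ v, ¬ P.Thin v) : IsPhyloTree X P.net := by
  refine ⟨P.isPhyloNet hP, ?_⟩
  have := P.reticNum_le
  simp at this
  exact this

theorem clusterBelow_eq (P : Pre 1 X V) (v : V) : P.net.clusterBelow (P.eq v) = P.cl 0 v := by
  have hr : ∀ a b, P.net.Reaches (P.eq a) (P.eq b) ↔ P.Reach 0 a b := by
    intro a b
    constructor
    · intro h
      have := Relation.ReflTransGen.lift (p := P.adj 0) P.eq.symm (by
        intro c d hcd
        obtain ⟨h1, i, h2⟩ := (P.mem_E (c, d)).1 hcd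
        rw [Subsingleton.elim i 0] at h2
        exact ⟨h1, h2⟩) _ _ h
      unfold Reach
      simpa [Function.onFun] using this
    · intro h
      exact Relation.ReflTransGen.lift (r := P.adj 0) (p := P.net.Adj) P.eq
        (fun c d hcd => (P.net_adj c d).2 ⟨hcd.1, 0, hcd.2⟩) _ _ h
  ext y
  rw [P.cl_iff]
  unfold Net.clusterBelow
  simp only [Finset.mem_image, Finset.mem_filter, Finset.mem_univ, true_and]
  constructor
  · rintro ⟨k, ⟨h1, h2⟩, h3⟩
    obtain ⟨u, rfl⟩ := P.eq.surjective k
    obtain ⟨x, hx, rfl⟩ := (P.isLeaf_iff u).1 h2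
    rw [net_label, P.lab_leaf x hx] at h3
    subst h3
    exact ⟨hx, (hr _ _).1 h1⟩
  · rintro ⟨hy, h⟩
    exact ⟨P.eq (P.leaf y), ⟨(hr _ _).2 h, (P.isLeaf_iff _).2 ⟨y, hy, rfl⟩⟩, by
      rw [net_label, P.lab_leaf y hy]⟩

end Pre

set_option linter.unusedSectionVars false
namespace Pre

variable {m : ℕ} {X : Finset α} {V : Type} [Fintype V]

def Kept (P : Pre m X V) (i : Fin m) (v : V) : Prop := v = P.root ∨ ¬ ∃! u, P.adj i v u

theorem not_kept (P : Pre m X V) (i : Fin m) {v : V} (h : ¬ P.Kept i v) :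
    v ≠ P.root ∧ ∃ u, P.adj i v u ∧ ∀ u', P.adj i v u' → u' = u := by
  unfold Kept at h
  push Not at h
  exact h

noncomputable def up (P : Pre m X V) (i : Fin m) (v : V) : V :=
  if h : P.Kept i v then v else up P i (P.par i v)
termination_by P.h v
decreasing_by exact P.h_lt i v (fun hr => h (Or.inl hr))

noncomputable def pth (P : Pre m X V) (i : Fin m) (v : V) : List V :=
  if h : P.Kept i v then [v] else pth P i (P.par i v) ++ [v]
termination_by P.h v
decreasing_by exact P.h_lt i v (fun hr => h (Or.inl hr))

noncomputable def dn (P : Pre m X V) (i : Fin m) (v : V) : V :=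
  if h : P.Kept i v then v else dn P i (Classical.choose (P.not_kept i h).2)
termination_by Finset.univ.sup P.h - P.h v
decreasing_by
  have h1 := (Classical.choose_spec (P.not_kept i h).2).1
  have h2 := P.h_lt i _ h1.1
  rw [h1.2] at h2
  have h3 : P.h (Classical.choose (P.not_kept i h).2) ≤ Finset.univ.sup P.h :=
    Finset.le_sup (Finset.mem_univ _)
  omega

theorem up_pos (P : Pre m X V) (i : Fin m) {v : V} (h : P.Kept i v) : P.up i v = v := by
  rw [up, dif_pos h]

theorem up_neg (P : Pre m X V) (i : Fin m) {v : V} (h : ¬ P.Kept i v) :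
    P.up i v = P.up i (P.par i v) := by
  rw [up, dif_neg h]

theorem pth_pos (P : Pre m X V) (i : Fin m) {v : V} (h : P.Kept i v) : P.pth i v = [v] := by
  rw [pth, dif_pos h]

theorem pth_neg (P : Pre m X V) (i : Fin m) {v : V} (h : ¬ P.Kept i v) :
    P.pth i v = P.pth i (P.par i v) ++ [v] := by
  rw [pth, dif_neg h]

theorem dn_pos (P : Pre m X V) (i : Fin m) {v : V} (h : P.Kept i v) : P.dn i v = v := by
  rw [dn, dif_pos h]

theorem dn_neg (P : Pre m X V) (i : Fin m) {v u : V} (h : ¬ P.Kept i v) (hu : P.adj i v u) :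
    P.dn i v = P.dn i u := by
  rw [dn, dif_neg h, (Classical.choose_spec (P.not_kept i h).2).2 u hu]

theorem kept_up (P : Pre m X V) (i : Fin m) : ∀ v, P.Kept i (P.up i v) := by
  apply P.up_induct i
  intro v ih
  by_cases h : P.Kept i v
  · rw [P.up_pos i h]; exact h
  · rw [P.up_neg i h]; exact ih (P.not_kept i h).1

theorem reach_up (P : Pre m X V) (i : Fin m) : ∀ v, P.Reach i (P.up i v) v := by
  apply P.up_induct i
  intro v ih
  by_cases h : P.Kept i v
  · rw [P.up_pos i h]; exact Relation.ReflTransGen.refl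
  · rw [P.up_neg i h]
    exact Relation.ReflTransGen.tail (ih (P.not_kept i h).1) ⟨(P.not_kept i h).1, rfl⟩

theorem kept_dn (P : Pre m X V) (i : Fin m) : ∀ v, P.Kept i (P.dn i v) := by
  apply P.down_induct i
  intro v ih
  by_cases h : P.Kept i v
  · rw [P.dn_pos i h]; exact h
  · obtain ⟨_, u, hu, _⟩ := P.not_kept i h
    rw [P.dn_neg i h hu]
    exact ih u hu.1 hu.2

theorem reach_dn (P : Pre m X V) (i : Fin m) : ∀ v, P.Reach i v (P.dn i v) := by
  apply P.down_induct i
  intro v ih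
  by_cases h : P.Kept i v
  · rw [P.dn_pos i h]; exact Relation.ReflTransGen.refl
  · obtain ⟨_, u, hu, _⟩ := P.not_kept i h
    rw [P.dn_neg i h hu]
    exact Relation.ReflTransGen.head hu (ih u hu.1 hu.2)

theorem dn_ne_root (P : Pre m X V) (i : Fin m) : ∀ v, v ≠ P.root → P.dn i v ≠ P.root := by
  apply P.down_induct i
  intro v ih hv
  by_cases h : P.Kept i v
  · rw [P.dn_pos i h]; exact hv
  · obtain ⟨_, u, hu, _⟩ := P.not_kept i h
    rw [P.dn_neg i h hu]
    exact ih u hu.1 hu.2 hu.1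

theorem leaf_kept (P : Pre m X V) (i : Fin m) {x : α} (hx : x ∈ X) : P.Kept i (P.leaf x) := by
  right
  rintro ⟨u, hu, _⟩
  exact P.leaf_ne_par x hx i u hu.1 hu.2

theorem cl_dn (P : Pre m X V) (i : Fin m) : ∀ v, P.cl i (P.dn i v) = P.cl i v := by
  apply P.down_induct i
  intro v ih
  by_cases h : P.Kept i v
  · rw [P.dn_pos i h]
  · obtain ⟨_, u, hu, hu'⟩ := P.not_kept i h
    rw [P.dn_neg i h hu, ih u hu.1 hu.2]
    ext y
    rw [P.cl_node i v]
    · constructor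
      · intro hy
        exact ⟨u, hu.1, hu.2, hy⟩
      · rintro ⟨u', h1, h2, h3⟩
        rw [← hu' u' ⟨h1, h2⟩]
        exact h3
    · rintro x hx rfl
      exact h (P.leaf_kept i hx)

theorem up_par_dn (P : Pre m X V) (i : Fin m) :
    ∀ u, u ≠ P.root → P.up i (P.par i (P.dn i u)) = P.up i (P.par i u) := by
  apply P.down_induct i
  intro v ih hv
  by_cases h : P.Kept i v
  · rw [P.dn_pos i h]
  · obtain ⟨_, u, hu, hu'⟩ := P.not_kept i h
    rw [P.dn_neg i h hu, ih u hu.1 hu.2 hu.1, hu.2, P.up_neg i h]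

theorem dn_inj (P : Pre m X V) (i : Fin m) {v u u' : V} (hu : P.adj i v u) (hu' : P.adj i v u')
    (h : P.dn i u = P.dn i u') : u = u' := by
  have key : ∀ u u', P.adj i v u → P.adj i v u' → P.Reach i u u' → u = u' := by
    intro u u' hu hu' hr
    rcases Relation.ReflTransGen.cases_tail hr with h | ⟨c, hc, hc'⟩
    · exact h.symm
    · have h1 := P.reach_h i hc
      rw [← hc'.2, hu'.2] at h1
      have h2 := P.h_lt i u hu.1
      rw [hu.2] at h2
      omega
  have h1 := P.reach_dn i u
  have h2 := P.reach_dn i u'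
  rw [h] at h1
  rcases P.reach_total i h1 h2 with h | h
  · exact key _ _ hu hu' h
  · exact (key _ _ hu' hu h).symm

theorem pth_ne (P : Pre m X V) (i : Fin m) (v : V) : P.pth i v ≠ [] := by
  by_cases h : P.Kept i v
  · rw [P.pth_pos i h]; simp
  · rw [P.pth_neg i h]; simp

theorem pth_last (P : Pre m X V) (i : Fin m) (v : V) : (P.pth i v).getLast? = some v := by
  by_cases h : P.Kept i v
  · rw [P.pth_pos i h]; simp
  · rw [P.pth_neg i h]; simp

theorem pth_head (P : Pre m X V) (i : Fin m) : ∀ v, (P.pth i v).head? = some (P.up i v) := by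
  apply P.up_induct i
  intro v ih
  by_cases h : P.Kept i v
  · rw [P.pth_pos i h, P.up_pos i h]; simp
  · rw [P.pth_neg i h, P.up_neg i h, List.head?_append, ih (P.not_kept i h).1]; simp

theorem pth_chain (P : Pre m X V) (i : Fin m) : ∀ v, (P.pth i v).IsChain (P.adj i) := by
  apply P.up_induct i
  intro v ih
  by_cases h : P.Kept i v
  · rw [P.pth_pos i h]; exact List.isChain_singleton _
  · rw [P.pth_neg i h, List.isChain_append]
    refine ⟨ih (P.not_kept i h).1, List.isChain_singleton _, ?_⟩
    intro x hx y hy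
    rw [pth_last] at hx
    simp at hx hy
    subst hx hy
    exact ⟨(P.not_kept i h).1, rfl⟩

theorem pth_tail (P : Pre m X V) (i : Fin m) :
    ∀ v, ∀ w ∈ (P.pth i v).tail, ¬ P.Kept i w ∧ ¬ P.Kept i v ∧ P.dn i w = P.dn i v := by
  apply P.up_induct i
  intro v ih w hw
  by_cases h : P.Kept i v
  · rw [P.pth_pos i h] at hw; simp at hw
  · rw [P.pth_neg i h, List.tail_append_of_ne_nil (P.pth_ne i _), List.mem_append] at hw
    rcases hw with hw | hw
    · obtain ⟨h1, h2, h3⟩ := ih (P.not_kept i h).1 w hw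
      exact ⟨h1, h, h3.trans (P.dn_neg i h2 ⟨(P.not_kept i h).1, rfl⟩)⟩
    · rw [List.mem_singleton] at hw
      subst hw
      exact ⟨h, h, rfl⟩

noncomputable def tree (P : Pre m X V) (i : Fin m) : Pre 1 X {v // P.Kept i v} where
  root := ⟨P.root, Or.inl rfl⟩
  par _ v := ⟨P.up i (P.par i v.1), P.kept_up i _⟩
  h v := P.h v.1
  leaf x := if hx : x ∈ X then ⟨P.leaf x, P.leaf_kept i hx⟩ else ⟨P.root, Or.inl rfl⟩
  lab v := P.lab v.1
  cl _ v := P.cl i v.1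
  h_lt := by
    intro _ v hv
    have h1 := P.reach_h i (P.reach_up i (P.par i v.1))
    have h2 := P.h_lt i v.1 (fun h => hv (Subtype.ext h))
    exact lt_of_le_of_lt h1 h2
  lab_leaf := by
    intro x hx
    rw [dif_pos hx]
    exact P.lab_leaf x hx
  leaf_ne_root := by
    intro x hx
    rw [dif_pos hx]
    intro h
    exact P.leaf_ne_root x hx (congrArg Subtype.val h)
  leaf_const := by
    intro x hx _ _
    rfl
  leaf_ne_par := by
    intro x hx _ v hv h
    rw [dif_pos hx] at h
    have h1 : P.up i (P.par i v.1) = P.leaf x := congrArg Subtype.val h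
    have h2 := P.reach_up i (P.par i v.1)
    rw [h1] at h2
    exact P.leaf_ne_par x hx i v.1 (fun h => hv (Subtype.ext h)) (P.reach_leaf i hx h2)
  cl_leaf := by
    intro x hx _
    rw [dif_pos hx]
    exact P.cl_leaf x hx i
  cl_node := by
    rintro _ ⟨v, hk⟩ hv y
    have hv' : ∀ x ∈ X, v ≠ P.leaf x := by
      rintro x hx rfl
      apply hv x hx
      rw [dif_pos hx]
    constructor
    · intro hy
      obtain ⟨u, h1, h2, h3⟩ := (P.cl_node i v hv' y).1 hy
      refine ⟨⟨P.dn i u, P.kept_dn i u⟩, ?_, ?_, ?_⟩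
      · intro h
        exact P.dn_ne_root i u h1 (congrArg Subtype.val h)
      · apply Subtype.ext
        show P.up i (P.par i (P.dn i u)) = v
        rw [P.up_par_dn i u h1, h2, P.up_pos i hk]
      · show y ∈ P.cl i (P.dn i u)
        rw [P.cl_dn]
        exact h3
    · rintro ⟨⟨b, hb⟩, h1, h2, h3⟩
      have h2' : P.up i (P.par i b) = v := congrArg Subtype.val h2
      show y ∈ P.cl i v
      refine P.cl_mono i ?_ h3
      have := P.reach_up i (P.par i b)
      rw [h2'] at this
      exact this.tail ⟨fun h => h1 (Subtype.ext h), rfl⟩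
  child_ex := by
    rintro _ ⟨v, hk⟩ hv
    have hv' : ∀ x ∈ X, v ≠ P.leaf x := by
      rintro x hx rfl
      apply hv x hx
      rw [dif_pos hx]
    obtain ⟨u, h1, h2⟩ := P.child_ex i v hv'
    refine ⟨⟨P.dn i u, P.kept_dn i u⟩, ?_, ?_⟩
    · intro h
      exact P.dn_ne_root i u h1 (congrArg Subtype.val h)
    · apply Subtype.ext
      show P.up i (P.par i (P.dn i u)) = v
      rw [P.up_par_dn i u h1, h2, P.up_pos i hk]

theorem tree_not_thin (P : Pre m X V) (i : Fin m) (v) : ¬ (P.tree i).Thin v := by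
  obtain ⟨v, hk⟩ := v
  rintro ⟨h1, -, ⟨b, hb, hb'⟩⟩
  have hv : v ≠ P.root := fun h => h1 (Subtype.ext h)
  have hnl : ∀ x ∈ X, v ≠ P.leaf x := by
    rintro x hx rfl
    obtain ⟨h2, j, h3⟩ := hb
    apply (P.tree i).leaf_ne_par x hx j b h2
    rw [h3]
    show _ = dite _ _ _
    rw [dif_pos hx]
  obtain ⟨u, hu1, hu2⟩ := P.child_ex i v hnl
  rcases hk with h | h
  · exact hv h
  · apply h
    refine ⟨u, ⟨hu1, hu2⟩, ?_⟩
    have key : ∀ u', P.adj i v u' → P.dn i u' = b.1 := by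
      intro u' hu'
      have := hb' ⟨P.dn i u', P.kept_dn i u'⟩ ⟨fun h => P.dn_ne_root i u' hu'.1
        (congrArg Subtype.val h), 0, ?_⟩
      · exact congrArg Subtype.val this
      · apply Subtype.ext
        show P.up i (P.par i (P.dn i u')) = v
        rw [P.up_par_dn i u' hu'.1, hu'.2, P.up_pos i (Or.inr h)]
    intro u' hu'
    exact P.dn_inj i hu' ⟨hu1, hu2⟩ ((key u' hu').trans (key u ⟨hu1, hu2⟩).symm)

theorem displays (P : Pre m X V) (i : Fin m) : Displays P.net (P.tree i).net := by
  haveI : NeZero m := ⟨fun h => by subst h; exact i.elim0⟩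
  let e := (P.tree i).eq
  have hE : ∀ p ∈ (P.tree i).net.E, (e.symm p.2).1 ≠ P.root ∧
      P.up i (P.par i (e.symm p.2).1) = (e.symm p.1).1 := by
    intro p hp
    obtain ⟨h1, j, h2⟩ := ((P.tree i).mem_E p).1 hp
    exact ⟨fun h => h1 (Subtype.ext h), congrArg Subtype.val h2⟩
  have hint : ∀ b : V, internals ((P.pth i (P.par i b) ++ [b]).map P.eq) =
      ((P.pth i (P.par i b)).tail).map P.eq := by
    intro b
    unfold internals
    rw [← List.map_tail, ← List.map_dropLast, List.tail_append_of_ne_nil (P.pth_ne i _),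
      List.dropLast_concat]
  refine ⟨fun k => P.eq (e.symm k).1, ?_, ?_,
    fun p => (P.pth i (P.par i (e.symm p.2).1) ++ [(e.symm p.2).1]).map P.eq, ?_, ?_, ?_⟩
  · intro a b h
    exact e.symm.injective (Subtype.ext (P.eq.injective h))
  · intro k hk
    obtain ⟨v, rfl⟩ := e.surjective k
    obtain ⟨x, hx, rfl⟩ := ((P.tree i).isLeaf_iff v).1 hk
    have h1 : ((P.tree i).leaf x).1 = P.leaf x := by
      show (dite _ _ _ : {v // P.Kept i v}).1 = _
      rw [dif_pos hx]
    simp only [Equiv.symm_apply_apply]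
    rw [h1]
    refine ⟨(P.isLeaf_iff _).2 ⟨x, hx, rfl⟩, ?_⟩
    rw [net_label, P.lab_leaf x hx]
    exact (((P.tree i).net_label _).trans ((P.tree i).lab_leaf x hx)).symm
  · intro p hp
    obtain ⟨h1, h2⟩ := hE p hp
    refine ⟨?_, ?_, ?_, ?_⟩
    · rw [List.head?_map, List.head?_append, pth_head, h2]; simp
    · rw [List.getLast?_map, List.getLast?_concat]; simp
    · show List.IsChain _ _
      rw [List.isChain_map]
      have hc : (P.pth i (P.par i (e.symm p.2).1) ++ [(e.symm p.2).1]).IsChain (P.adj i) := by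
        rw [List.isChain_append]
        refine ⟨P.pth_chain i _, List.isChain_singleton _, ?_⟩
        intro x hx y hy
        rw [pth_last] at hx
        simp at hx hy
        subst hx hy
        exact ⟨h1, rfl⟩
      refine List.IsChain.imp ?_ hc
      intro a b hab
      exact (P.net_adj a b).2 ⟨hab.1, i, hab.2⟩
    · have := List.length_pos_of_ne_nil (P.pth_ne i (P.par i (e.symm p.2).1))
      simp
      omega
  · rintro p hp w hw ⟨k, rfl⟩
    simp only at hw
    rw [hint, List.mem_map] at hw
    obtain ⟨u, hu, he⟩ := hw
    have := P.eq.injective he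
    subst this
    exact (P.pth_tail i _ _ hu).1 (e.symm k).2
  · intro p hp q hq hpq w hw hw'
    simp only at hw hw'
    rw [hint, List.mem_map] at hw hw'
    obtain ⟨u, hu, rfl⟩ := hw
    obtain ⟨u', hu', he⟩ := hw'
    have := P.eq.injective he
    subst this
    have key : ∀ p ∈ (P.tree i).net.E, u' ∈ (P.pth i (P.par i (e.symm p.2).1)).tail →
        P.dn i u' = (e.symm p.2).1 := by
      intro p hp hu
      obtain ⟨_, h2, h3⟩ := P.pth_tail i _ _ hu
      rw [h3, P.dn_neg i h2 ⟨(hE p hp).1, rfl⟩, P.dn_pos i (e.symm p.2).2]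
    have h2 : p.2 = q.2 :=
      e.symm.injective (Subtype.ext ((key p hp hu).symm.trans (key q hq hu')))
    have h1 : p.1 = q.1 := by
      apply e.symm.injective
      apply Subtype.ext
      rw [← (hE p hp).2, ← (hE q hq).2, h2]
    exact hpq (Prod.ext h1 h2)

theorem represents (P : Pre m X V) (i : Fin m) (C : Finset α) (h : P.Has i C) :
    RepresentsCluster X P.net C := by
  obtain ⟨v, hv, -, rfl⟩ := h
  refine ⟨(P.tree i).net, (P.tree i).isPhyloTree (P.tree_not_thin i), P.displays i,
    ((P.tree i).eq ⟨P.up i (P.par i (P.dn i v)), P.kept_up i _⟩,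
      (P.tree i).eq ⟨P.dn i v, P.kept_dn i v⟩), ?_, ?_⟩
  · apply ((P.tree i).mem_E _).2
    simp only [Equiv.symm_apply_apply]
    exact ⟨fun h => P.dn_ne_root i v hv (congrArg Subtype.val h), 0, rfl⟩
  · rw [clusterBelow_eq]
    exact P.cl_dn i v

end Pre

set_option linter.unusedSectionVars false

theorem exists_leaf (N : Net α) (hac : ∀ v : Fin N.n, ¬ Relation.TransGen N.Adj v v)
    (v : Fin N.n) : ∃ w, N.Reaches v w ∧ N.IsLeaf w := by
  let r : Fin N.n → Fin N.n → Prop := fun a b => Relation.TransGen N.Adj b a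
  have h1 : IsTrans _ r := ⟨fun a b c hab hbc => Relation.TransGen.trans hbc hab⟩
  have h2 : Std.Irrefl r := ⟨hac⟩
  have wf : WellFounded r := Finite.wellFounded_of_trans_of_irrefl r
  induction v using wf.induction with
  | _ v ih =>
    by_cases hv : N.IsLeaf v
    · exact ⟨v, Relation.ReflTransGen.refl, hv⟩
    · unfold Net.IsLeaf Net.outdeg at hv
      obtain ⟨e, he⟩ := Finset.card_pos.1 (Nat.pos_of_ne_zero hv)
      obtain ⟨he1, he2⟩ := Finset.mem_filter.1 he
      have hadj : N.Adj v e.2 := by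
        unfold Net.Adj
        rw [← he2]
        exact he1
      obtain ⟨w, hw, hw'⟩ := ih e.2 (Relation.TransGen.single hadj)
      exact ⟨w, Relation.ReflTransGen.head hadj hw, hw'⟩

theorem mem_clusterBelow (N : Net α) (v : Fin N.n) (y : α) :
    y ∈ N.clusterBelow v ↔ ∃ w, N.Reaches v w ∧ N.IsLeaf w ∧ N.label w = y := by
  unfold Net.clusterBelow
  rw [Finset.mem_image]
  constructor
  · rintro ⟨w, hw, h⟩
    have := (Finset.mem_filter.1 hw).2
    exact ⟨w, this.1, this.2, h⟩
  · rintro ⟨w, h1, h2, h3⟩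
    exact ⟨w, Finset.mem_filter.2 ⟨Finset.mem_univ _, h1, h2⟩, h3⟩

theorem net_nonempty {X : Finset α} {N : Net α} (hN : IsPhyloNet X N) : X.Nonempty := by
  obtain ⟨ρ, _, _⟩ := hN.2.1
  obtain ⟨w, _, hw⟩ := exists_leaf N hN.1 ρ
  exact ⟨_, hN.2.2.2.2.1 hw⟩

theorem clSet_sub {X : Finset α} {N : Net α} (hN : IsPhyloNet X N) (C : Finset α)
    (hC : C ∈ clSet N) : C ⊆ X ∧ C.Nonempty := by
  obtain ⟨e, he, rfl⟩ := hC
  constructor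
  · intro y hy
    obtain ⟨w, _, h2, rfl⟩ := (mem_clusterBelow _ _ _).1 hy
    exact hN.2.2.2.2.1 h2
  · obtain ⟨w, h1, h2⟩ := exists_leaf N hN.1 e.2
    exact ⟨_, (mem_clusterBelow _ _ _).2 ⟨w, h1, h2, rfl⟩⟩

theorem clSet_compat {X : Finset α} {N : Net α} (hN : IsPhyloTree X N) :
    PairwiseCompatible (clSet N) := by
  rintro _ ⟨e, he, rfl⟩ _ ⟨f, hf, rfl⟩
  unfold Compatible
  by_cases hne : N.clusterBelow e.2 ∩ N.clusterBelow f.2 = ∅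
  · exact Or.inl hne
  right
  obtain ⟨y, hy⟩ := Finset.nonempty_iff_ne_empty.2 hne
  rw [Finset.mem_inter] at hy
  obtain ⟨w, h1, h2, h3⟩ := (mem_clusterBelow _ _ _).1 hy.1
  obtain ⟨w', h1', h2', h3'⟩ := (mem_clusterBelow _ _ _).1 hy.2
  have : w = w' := hN.1.2.2.2.2.2.1 h2 h2' (h3.trans h3'.symm)
  subst this
  have hind : ∀ v, N.indeg v ≤ 1 := by
    intro v
    have h0 : (∑ v, (N.indeg v - 1)) = 0 := hN.2
    have := (Finset.sum_eq_zero_iff.1 h0) v (Finset.mem_univ v)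
    omega
  have hu : Relator.RightUnique (Function.swap N.Adj) := by
    intro x y z hy hz
    have h := hind x
    unfold Net.indeg at h
    rw [Finset.card_le_one] at h
    have := h (y, x) (Finset.mem_filter.2 ⟨hy, rfl⟩) (z, x) (Finset.mem_filter.2 ⟨hz, rfl⟩)
    exact (Prod.mk.inj this).1
  have key : ∀ a b, N.Reaches a b → N.clusterBelow b ⊆ N.clusterBelow a := by
    intro a b hab y hy
    obtain ⟨w, h1, h2⟩ := (mem_clusterBelow _ _ _).1 hy
    exact (mem_clusterBelow _ _ _).2 ⟨w, hab.trans h1, h2⟩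
  have k1 : Relation.ReflTransGen (Function.swap N.Adj) w e.2 := (Relation.reflTransGen_swap).2 h1
  have k2 : Relation.ReflTransGen (Function.swap N.Adj) w f.2 := (Relation.reflTransGen_swap).2 h1'
  rcases Relation.ReflTransGen.total_of_right_unique hu k1 k2 with h | h
  · left; exact key _ _ ((Relation.reflTransGen_swap).1 h)
  · right; exact key _ _ ((Relation.reflTransGen_swap).1 h)

theorem exists_maxSeq (n : ℕ) : ∀ (X : Finset α) (𝒞 : Set (Finset α)), X.card ≤ n →
    (∀ C ∈ 𝒞, C ⊆ X) → ∃ L, IsMaxSTTreeSeq X 𝒞 L := by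
  have hempty : ∀ (X : Finset α) (𝒞 : Set (Finset α)), X = ∅ →
      (∀ C ∈ 𝒞, C ⊆ X) → ∃ L, IsMaxSTTreeSeq X 𝒞 L := by
    rintro X 𝒞 rfl h
    refine ⟨[], trivial, ?_⟩
    intro A hA B hB
    right; left
    exact (h A hA).trans (Finset.empty_subset _)
  induction n with
  | zero =>
    intro X 𝒞 hX h
    exact hempty X 𝒞 (Finset.card_eq_zero.1 (by omega)) h
  | succ n ih =>
    intro X 𝒞 hX h
    rcases X.eq_empty_or_nonempty with h0 | ⟨x, hx⟩
    · exact hempty X 𝒞 h0 h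
    have hst : IsSTSet X 𝒞 {x} := by
      refine ⟨Finset.singleton_subset_iff.2 hx, ?_, ?_⟩
      · intro C _
        by_cases hc : x ∈ C
        · exact Or.inr (Or.inr (Finset.singleton_subset_iff.2 hc))
        · left
          ext y
          simp only [Finset.mem_inter, Finset.mem_singleton, Finset.notMem_empty, iff_false]
          rintro ⟨hy, rfl⟩
          exact hc hy
      · rintro A ⟨hA, A', _, rfl⟩ B ⟨hB, B', _, rfl⟩
        right; left
        obtain ⟨b, hb⟩ := hB
        have hb2 := hb
        rw [Finset.mem_inter, Finset.mem_singleton] at hb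
        intro a ha
        rw [Finset.mem_inter, Finset.mem_singleton] at ha
        rw [hb.2] at hb2
        rw [ha.2]
        exact hb2
    obtain ⟨S, hS, hmax⟩ := Finset.exists_max_image (X.powerset.filter fun S => IsSTSet X 𝒞 S)
      Finset.card ⟨{x}, Finset.mem_filter.2 ⟨Finset.mem_powerset.2 hst.1, hst⟩⟩
    have hS' := (Finset.mem_filter.1 hS).2
    have hm : IsMaxSTSet X 𝒞 S := by
      refine ⟨hS', ?_⟩
      intro S' h1 h2
      have := hmax S' (Finset.mem_filter.2 ⟨Finset.mem_powerset.2 h1.1, h1⟩)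
      have := Finset.card_lt_card h2
      omega
    have hpos : 1 ≤ S.card := by
      have := hmax {x} (Finset.mem_filter.2 ⟨Finset.mem_powerset.2 hst.1, hst⟩)
      simpa using this
    have hcard : (X \ S).card ≤ n := by
      rw [Finset.card_sdiff_of_subset hS'.1]
      omega
    obtain ⟨L, hL1, hL2⟩ := ih (X \ S) (removeTaxa 𝒞 S) hcard (by
      rintro D ⟨_, C, hC, rfl⟩
      exact Finset.sdiff_subset_sdiff (h C hC) (Finset.Subset.refl _))
    exact ⟨S :: L, ⟨hm, hL1⟩, hL2⟩

theorem isSTSeq_of_max (L : List (Finset α)) : ∀ (X : Finset α) (𝒞 : Set (Finset α)),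
    IsMaxSTSeq X 𝒞 L → IsSTSeq X 𝒞 L := by
  induction L with
  | nil => intro _ _ _; trivial
  | cons S L ih =>
    intro X 𝒞 h
    exact ⟨h.1.1, ih _ _ h.2⟩


/-- Theorem: MST upper bound.  Let `𝒯 = {T_1, …, T_m}` be a set of `m`
rooted phylogenetic trees on a finite taxa set `X` and let `𝒞 = Cl(𝒯)`.  Let `p` be the
MST lower bound for `𝒞`.  Then `r(𝒞) ≤ (m − 1)·p`. -/
theorem rNum_le_mst_mul {α : Type} [DecidableEq α] (X : Finset α) (m : ℕ)
    (T : Fin m → Net α) (hT : ∀ i, IsPhyloTree X (T i)) :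
    rNum X (⋃ i, clSet (T i)) ≤ (m - 1) * mstLB X (⋃ i, clSet (T i)) := by
  rcases X.eq_empty_or_nonempty with h0 | hX
  · have : {k | ∃ N : Net α, IsPhyloNet X N ∧ RepresentsSet X N (⋃ i, clSet (T i)) ∧
        N.reticNum = k} = ∅ := by
      rw [Set.eq_empty_iff_forall_notMem]
      rintro k ⟨N, hN, _⟩
      exact (net_nonempty hN).ne_empty h0
    unfold rNum
    rw [this, Nat.sInf_empty]
    exact Nat.zero_le _
  have hsub : ∀ C ∈ ⋃ i, clSet (T i), C ⊆ X ∧ C.Nonempty := by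
    intro C hC
    obtain ⟨i, hi⟩ := Set.mem_iUnion.1 hC
    exact clSet_sub (hT i).1 C hi
  by_cases hm : 2 ≤ m
  · obtain ⟨L0, hL0⟩ := exists_maxSeq X.card X (⋃ i, clSet (T i)) le_rfl (fun C hC => (hsub C hC).1)
    have hne : {p | ∃ L, IsMaxSTTreeSeq X (⋃ i, clSet (T i)) L ∧ L.length = p}.Nonempty :=
      ⟨_, L0, hL0, rfl⟩
    obtain ⟨L, hL, hlen⟩ := Nat.sInf_mem hne
    obtain ⟨V, _, P, h1, h2, h3⟩ := Pre.exists_main hm L X (fun i => clSet (T i)) hX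
      (fun i C hC => clSet_sub (hT i).1 C hC) (fun i => clSet_compat (hT i))
      ⟨isSTSeq_of_max L _ _ hL.1, hL.2⟩
    have : NeZero m := ⟨by omega⟩
    have hr : rNum X (⋃ i, clSet (T i)) ≤ P.net.reticNum := by
      apply Nat.sInf_le
      refine ⟨P.net, P.isPhyloNet h1, ?_, rfl⟩
      intro C hC
      obtain ⟨i, hi⟩ := Set.mem_iUnion.1 hC
      exact P.represents i C (h3 i C (Or.inl hi))
    refine hr.trans (P.reticNum_le.trans (Nat.mul_le_mul_left _ ?_))
    unfold mstLB
    rw [← hlen]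
    exact h2
  · have hcomp : PairwiseCompatible (⋃ i, clSet (T i)) := by
      intro A hA B hB
      obtain ⟨i, hi⟩ := Set.mem_iUnion.1 hA
      obtain ⟨j, hj⟩ := Set.mem_iUnion.1 hB
      have : i = j := Fin.ext (by omega)
      subst this
      exact clSet_compat (hT i) A hi B hj
    obtain ⟨V, _, P, _, h1, h3⟩ := Pre.exists_base 1 X hX (⋃ i, clSet (T i)) hsub hcomp
    have hr : rNum X (⋃ i, clSet (T i)) ≤ P.net.reticNum := by
      apply Nat.sInf_le
      refine ⟨P.net, P.isPhyloNet h1, ?_, rfl⟩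
      intro C hC
      exact P.represents 0 C (h3 0 C (Or.inl hC))
    rw [(P.isPhyloTree h1).2] at hr
    omega


end Phylo
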